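/- If f : ℝ³ → ℂ is continuously differentiable with f ∈ L⁶(ℝ³), ∇f ∈ L²(ℝ³), and ‖∇f‖_{L²} ≤ ‖∇W‖_{L²}, then ‖∇f‖_{L²}² · E^c(W) ≤ ‖∇W‖_{L²}² · E^c(f). In particular E^c(f) ≥ 0, and ‖f‖_{L⁶}⁶ ≤ (‖∇f‖_{L²}/‖∇W‖_{L²})⁴ ‖∇f‖_{L²}². -/

import Mathlib

open MeasureTheory Complex
open scoped BigOperators ENNReal

noncomputable section

abbrev E3 := EuclideanSpace ℝ (Fin 3)

/-- The Aubin–Talenti ground state `W(x) = (1 + |x|²/3)^(-1/2)`. -/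
def W (x : E3) : ℝ := (1 + ‖x‖ ^ 2 / 3) ^ (-(1 : ℝ) / 2)

/-- `W` viewed as a complex-valued function. -/
def Wc (x : E3) : ℂ := (W x : ℂ)

/-- Standard basis vectors of ℝ³. -/
def e3 (i : Fin 3) : E3 := EuclideanSpace.single i 1

/-- Partial derivative of a real-valued function. -/
def pdR (i : Fin 3) (f : E3 → ℝ) (x : E3) : ℝ := fderiv ℝ f x (e3 i)

/-- Partial derivative of a complex-valued function. -/
def pdC (i : Fin 3) (f : E3 → ℂ) (x : E3) : ℂ := fderiv ℝ f x (e3 i)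

/-- Squared gradient `|∇f|²` of a real-valued function. -/
def gradSqR (f : E3 → ℝ) (x : E3) : ℝ := ∑ i, (pdR i f x) ^ 2

/-- Squared gradient `|∇f|²` of a complex-valued function. -/
def gradSqC (f : E3 → ℂ) (x : E3) : ℝ := ∑ i, ‖pdC i f x‖ ^ 2

/-- Laplacian of a real-valued function. -/
def lapR (f : E3 → ℝ) (x : E3) : ℝ := ∑ i, pdR i (pdR i f) x

/-- Laplacian of a complex-valued function. -/
def lapC (f : E3 → ℂ) (x : E3) : ℂ := ∑ i, pdC i (pdC i f) x

/-- Quintic (energy-critical) energy `E^c`. -/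
def Ecrit (f : E3 → ℂ) : ℝ := ∫ x : E3, ((1:ℝ)/2 * gradSqC f x - 1/6 * ‖f x‖ ^ 6)

/-- Cubic–quintic energy `E`. -/
def Ecq (f : E3 → ℂ) : ℝ :=
  ∫ x : E3, ((1:ℝ)/2 * gradSqC f x - 1/6 * ‖f x‖ ^ 6 + 1/4 * ‖f x‖ ^ 4)

/-- Regular solutions of the cubic–quintic NLS on an interval `I ⊆ ℝ`. -/
def IsRegularSolution (I : Set ℝ) (u : ℝ → E3 → ℂ) : Prop :=
  ContDiffOn ℝ (⊤ : ℕ∞) (fun p : ℝ × E3 => u p.1 p.2) (I ×ˢ Set.univ) ∧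
  (∀ t ∈ I, ∀ x : E3, Complex.I * deriv (fun s => u s x) t + lapC (u t) x =
      (‖u t x‖ : ℂ) ^ 2 * u t x - (‖u t x‖ : ℂ) ^ 4 * u t x) ∧
  (∀ J : Set ℝ, IsCompact J → J ⊆ I → ∀ n k : ℕ, ∃ C : ℝ, ∀ t ∈ J, ∀ x : E3,
      (1 + ‖x‖) ^ n * ‖iteratedFDeriv ℝ k (u t) x‖ ≤ C)

/-- `q` maps `[0, 1]` onto `[-Θ, Θ]` and transports the uniform density to the density
`cos ^ k / c`. -/
structure IsCosQuantile (k : ℕ) (Θ c : ℝ) (q : ℝ → ℝ) : Prop where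
  continuous : Continuous q
  map_zero : q 0 = -Θ
  map_one : q 1 = Θ
  mem : ∀ v ∈ Set.Icc (0 : ℝ) 1, q v ∈ Set.Icc (-Θ) Θ
  hasDerivAt : ∀ v ∈ Set.Icc (0 : ℝ) 1, HasDerivAt q (c / Real.cos (q v) ^ k) v

/-- A positive continuous weight bounded away from zero has a primitive which is invertible,
with differentiable inverse. -/
lemma exists_inverse_primitive (w : ℝ → ℝ) (hw : Continuous w) (δ : ℝ) (hδ : 0 < δ)
    (hle : ∀ t, δ ≤ w t) (a : ℝ) :
    ∃ Q : ℝ → ℝ, StrictMono Q ∧ (∀ t, Q (∫ s in a..t, w s) = t) ∧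
      ∀ v, HasDerivAt Q (1 / w (Q v)) v := by
  set Ψ : ℝ → ℝ := fun t => ∫ s in a..t, w s with hΨ
  have hder : ∀ t, HasDerivAt Ψ (w t) t := fun t =>
    intervalIntegral.integral_hasDerivAt_right (hw.intervalIntegrable _ _)
      (hw.stronglyMeasurableAtFilter _ _) hw.continuousAt
  have hcont : Continuous Ψ := continuous_iff_continuousAt.2 fun t => (hder t).continuousAt
  have hmono : StrictMono Ψ :=
    strictMono_of_deriv_pos fun t => by rw [(hder t).deriv]; exact hδ.trans_le (hle t)
  have hgrow : Monotone fun t => Ψ t - δ * t := by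
    apply monotone_of_deriv_nonneg
    · exact fun t => ((hder t).sub ((hasDerivAt_id t).const_mul δ)).differentiableAt
    · intro t
      have := ((hder t).sub ((hasDerivAt_id t).const_mul δ)).deriv
      simp only [id] at this
      erw [this]
      have := hle t
      linarith
  have htop : Filter.Tendsto Ψ Filter.atTop Filter.atTop := by
    refine Filter.tendsto_atTop_mono' (f₁ := fun t => (Ψ 0 - δ * 0) + δ * t) _ ?_ ?_
    · filter_upwards [Filter.eventually_ge_atTop 0] with t ht
      have := hgrow ht
      simp only at this; linarith
    · exact Filter.tendsto_atTop_add_const_left _ _ (Filter.tendsto_id.const_mul_atTop hδ)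
  have hbot : Filter.Tendsto Ψ Filter.atBot Filter.atBot := by
    refine Filter.tendsto_atBot_mono' (f₁ := fun t => (Ψ 0 - δ * 0) + δ * t) _ ?_ ?_
    · filter_upwards [Filter.eventually_le_atBot 0] with t ht
      have := hgrow ht
      simp only at this; linarith
    · exact Filter.tendsto_atBot_add_const_left _ _ (Filter.tendsto_id.const_mul_atBot hδ)
  have hsurj : Function.Surjective Ψ := hcont.surjective htop hbot
  let e : ℝ ≃o ℝ := hmono.orderIsoOfSurjective Ψ hsurj
  refine ⟨e.symm, e.symm.strictMono, fun t => e.symm_apply_apply t, fun v => ?_⟩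
  have h := HasDerivAt.of_local_left_inverse (f := Ψ) (g := e.symm) (a := v)
    (f' := w (e.symm v)) e.symm.continuous.continuousAt (hder _)
    (hδ.trans_le (hle _)).ne' (Filter.Eventually.of_forall fun y => e.apply_symm_apply y)
  simpa [one_div] using h

lemma exists_isCosQuantile (k : ℕ) (Θ : ℝ) (h0 : 0 < Θ) (h1 : Θ < Real.pi / 2) :
    ∃ q, IsCosQuantile k Θ (∫ t in (-Θ)..Θ, Real.cos t ^ k) q := by
  set p : ℝ → ℝ := fun t => max (-Θ) (min Θ t) with hp
  have hpm : ∀ t, -Θ ≤ p t ∧ p t ≤ Θ := fun t =>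
    ⟨le_max_left _ _, max_le (by linarith) (min_le_left _ _)⟩
  have hpid : ∀ t ∈ Set.Icc (-Θ) Θ, p t = t := fun t ht => by
    simp only [hp]; rw [min_eq_right ht.2, max_eq_right ht.1]
  have hcosΘ : 0 < Real.cos Θ := Real.cos_pos_of_mem_Ioo ⟨by linarith, h1⟩
  have hpc : ∀ t, Real.cos Θ ≤ Real.cos (p t) := fun t => by
    rw [← Real.cos_abs (p t)]
    exact Real.cos_le_cos_of_nonneg_of_le_pi (abs_nonneg _) (by linarith [Real.pi_pos])
      (abs_le.2 (hpm t))
  obtain ⟨Q, hQm, hQi, hQd⟩ := exists_inverse_primitive (fun t => Real.cos (p t) ^ k)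
    (by fun_prop) (Real.cos Θ ^ k) (by positivity)
    (fun t => pow_le_pow_left₀ hcosΘ.le (hpc t) k) (-Θ)
  set c := ∫ t in (-Θ)..Θ, Real.cos t ^ k with hc
  have hcp : ∫ t in (-Θ)..Θ, Real.cos (p t) ^ k = c := by
    apply intervalIntegral.integral_congr
    intro t ht
    rw [Set.uIcc_of_le (by linarith)] at ht
    simp only [hpid t ht]
  have hc0 : 0 ≤ c := by
    rw [← hcp]
    apply intervalIntegral.integral_nonneg (by linarith)
    intro t _
    exact pow_nonneg (hcosΘ.le.trans (hpc t)) k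
  have hQ0 : Q 0 = -Θ := by simpa using hQi (-Θ)
  have hQ1 : Q c = Θ := by have := hQi Θ; rwa [hcp] at this
  have hmem : ∀ v ∈ Set.Icc (0 : ℝ) 1, Q (c * v) ∈ Set.Icc (-Θ) Θ := fun v hv => by
    rw [← hQ0]
    conv => { enter [1, 2]; rw [← hQ1] }
    exact ⟨hQm.monotone (mul_nonneg hc0 hv.1), hQm.monotone (by nlinarith [hv.2])⟩
  have hQc : Continuous Q := continuous_iff_continuousAt.2 fun t => (hQd t).continuousAt
  refine ⟨fun v => Q (c * v), by fun_prop, by simpa using hQ0, by simpa using hQ1, hmem, ?_⟩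
  intro v hv
  have := (hQd (c * v)).comp v ((hasDerivAt_id v).const_mul c)
  simp only [hpid _ (hmem v hv), mul_one] at this
  rw [one_div_mul_eq_div] at this
  exact this

/-- The angle associated with the distribution function of the density `ρ` on `[-R, R]`. -/
def angle (q : ℝ → ℝ) (R : ℝ) (ρ : ℝ → ℝ) (x : ℝ) : ℝ :=
  q ((∫ t in (-R)..x, ρ t) / ∫ t in (-R)..R, ρ t)

section Angle

variable {k : ℕ} {Θ c R : ℝ} {q ρ : ℝ → ℝ}

lemma cdf_mem (hρ : Continuous ρ) (hρ0 : ∀ x, 0 ≤ ρ x) {x : ℝ}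
    (hx : x ∈ Set.Icc (-R) R) :
    (∫ t in (-R)..x, ρ t) / (∫ t in (-R)..R, ρ t) ∈ Set.Icc (0 : ℝ) 1 := by
  have h1 : 0 ≤ ∫ t in (-R)..x, ρ t := intervalIntegral.integral_nonneg hx.1 fun t _ => hρ0 t
  have h2 : 0 ≤ ∫ t in x..R, ρ t := intervalIntegral.integral_nonneg hx.2 fun t _ => hρ0 t
  have h3 := intervalIntegral.integral_add_adjacent_intervals
    (hρ.intervalIntegrable (μ := volume) (-R) x) (hρ.intervalIntegrable x R)
  exact ⟨div_nonneg h1 (by linarith), div_le_one_of_le₀ (by linarith) (by linarith)⟩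

lemma angle_mem (hq : IsCosQuantile k Θ c q) (hρ : Continuous ρ)
    (hρ0 : ∀ x, 0 ≤ ρ x) {x : ℝ} (hx : x ∈ Set.Icc (-R) R) :
    angle q R ρ x ∈ Set.Icc (-Θ) Θ :=
  hq.mem _ (cdf_mem hρ hρ0 hx)

lemma cos_angle_pos (hq : IsCosQuantile k Θ c q) (hΘ : Θ < Real.pi / 2)
    (hρ : Continuous ρ) (hρ0 : ∀ x, 0 ≤ ρ x) {x : ℝ} (hx : x ∈ Set.Icc (-R) R) :
    0 < Real.cos (angle q R ρ x) := by
  have := angle_mem hq hρ hρ0 hx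
  exact Real.cos_pos_of_mem_Ioo ⟨by linarith [this.1], by linarith [this.2]⟩

lemma hasDerivAt_angle (hq : IsCosQuantile k Θ c q) (hρ : Continuous ρ)
    (hρ0 : ∀ x, 0 ≤ ρ x) {x : ℝ} (hx : x ∈ Set.Icc (-R) R) :
    HasDerivAt (angle q R ρ)
      (c / Real.cos (angle q R ρ x) ^ k * (ρ x / ∫ t in (-R)..R, ρ t)) x :=
  (hq.hasDerivAt _ (cdf_mem hρ hρ0 hx)).comp x
    ((intervalIntegral.integral_hasDerivAt_right (hρ.intervalIntegrable _ _)
      (hρ.stronglyMeasurableAtFilter _ _) hρ.continuousAt).div_const _)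

lemma continuous_angle (hq : IsCosQuantile k Θ c q) (hρ : Continuous ρ) :
    Continuous (angle q R ρ) := by
  unfold angle
  have h : Continuous fun x => ∫ t in (-R)..x, ρ t :=
    intervalIntegral.continuous_primitive (fun a b => hρ.intervalIntegrable a b) _
  exact hq.continuous.comp (h.div_const _)

lemma eq_zero_of_integral_eq_zero (hR : 0 < R) (hρ : Continuous ρ) (hρ0 : ∀ x, 0 ≤ ρ x)
    (hm : ∫ t in (-R)..R, ρ t = 0) {x : ℝ} (hx : x ∈ Set.Icc (-R) R) : ρ x = 0 := by
  by_contra hne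
  have : 0 < ∫ t in (-R)..R, ρ t :=
    intervalIntegral.integral_pos (by linarith) hρ.continuousOn (fun t _ => hρ0 t)
      ⟨x, hx, lt_of_le_of_ne (hρ0 x) (Ne.symm hne)⟩
  linarith

/-- The transported second moment `∫ ρ / cos² θ` in one variable. -/
lemma integral_div_cos_angle (hq : IsCosQuantile (k + 2) Θ c q) (hΘ : Θ < Real.pi / 2)
    (hc : 0 < c) (hR : 0 < R) (hρ : Continuous ρ) (hρ0 : ∀ x, 0 ≤ ρ x) :
    ∫ x in (-R)..R, ρ x / Real.cos (angle q R ρ x) ^ 2 =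
      (∫ x in (-R)..R, ρ x) * ((∫ t in (-Θ)..Θ, Real.cos t ^ k) / c) := by
  set m := ∫ x in (-R)..R, ρ x with hm
  rcases eq_or_ne m 0 with h0 | h0
  · rw [h0, zero_mul]
    rw [intervalIntegral.integral_congr (g := fun _ => 0)]
    · simp
    · intro x hx
      rw [Set.uIcc_of_le (by linarith)] at hx
      simp [eq_zero_of_integral_eq_zero hR hρ hρ0 h0 hx]
  · set Φ : ℝ → ℝ := fun t => ∫ s in (-Θ)..t, Real.cos s ^ k with hΦ
    have hΦd : ∀ t, HasDerivAt Φ (Real.cos t ^ k) t := fun t =>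
      intervalIntegral.integral_hasDerivAt_right (Continuous.intervalIntegrable (by fun_prop) _ _)
        (Continuous.stronglyMeasurableAtFilter (by fun_prop) _ _)
        (Continuous.continuousAt (by fun_prop))
    have hd : ∀ x ∈ Set.uIcc (-R) R, HasDerivAt (fun x => m / c * Φ (angle q R ρ x))
        (ρ x / Real.cos (angle q R ρ x) ^ 2) x := by
      intro x hx
      rw [Set.uIcc_of_le (by linarith)] at hx
      have hcos := cos_angle_pos hq hΘ hρ hρ0 hx
      have := (((hΦd _).comp x (hasDerivAt_angle hq hρ hρ0 hx))).const_mul (m / c)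
      have e : m / c * (Real.cos (angle q R ρ x) ^ k *
          (c / Real.cos (angle q R ρ x) ^ (k + 2) * (ρ x / m))) =
          ρ x / Real.cos (angle q R ρ x) ^ 2 := by
        field_simp
        ring
      rw [← hm, e] at this
      exact this
    rw [intervalIntegral.integral_eq_sub_of_hasDerivAt hd]
    · have e1 : angle q R ρ R = Θ := by
        unfold angle; rw [← hm, div_self h0, hq.map_one]
      have e2 : angle q R ρ (-R) = -Θ := by
        unfold angle; simp [hq.map_zero]
      simp only [e1, e2, hΦ, intervalIntegral.integral_same]
      ring
    · apply ContinuousOn.intervalIntegrable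
      rw [Set.uIcc_of_le (by linarith)]
      have := continuous_angle (R := R) hq hρ
      exact ContinuousOn.div hρ.continuousOn (by fun_prop)
        fun x hx => (pow_pos (cos_angle_pos hq hΘ hρ hρ0 hx) 2).ne'

/-- Derivative of `tan θ` along the transport. -/
def tanSlope (q : ℝ → ℝ) (k : ℕ) (c R : ℝ) (ρ : ℝ → ℝ) (x : ℝ) : ℝ :=
  1 / Real.cos (angle q R ρ x) ^ 2 *
    (c / Real.cos (angle q R ρ x) ^ k * (ρ x / ∫ t in (-R)..R, ρ t))

lemma tanSlope_nonneg (hq : IsCosQuantile k Θ c q) (hΘ : Θ < Real.pi / 2)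
    (hc : 0 < c) (hR : 0 < R) (hρ : Continuous ρ) (hρ0 : ∀ x, 0 ≤ ρ x) {x : ℝ}
    (hx : x ∈ Set.Icc (-R) R) : 0 ≤ tanSlope q k c R ρ x := by
  have hcos := cos_angle_pos hq hΘ hρ hρ0 hx
  have : 0 ≤ ∫ t in (-R)..R, ρ t :=
    intervalIntegral.integral_nonneg (by linarith) fun t _ => hρ0 t
  have := hρ0 x
  unfold tanSlope
  positivity

/-- Integration by parts against the transport map on one line. -/
lemma lintegral_mul_tanSlope_le (hq : IsCosQuantile k Θ c q) (hΘ : Θ < Real.pi / 2)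
    (hc : 0 < c) (hR : 0 < R) (hρ : Continuous ρ) (hρ0 : ∀ x, 0 ≤ ρ x) {u u' : ℝ → ℝ}
    (hu : ∀ x, HasDerivAt u (u' x) x) (hu' : Continuous u') (hu0 : ∀ x, 0 ≤ u x)
    (hul : u (-R) = 0) (hur : u R = 0) :
    ∫⁻ x in Set.Ioc (-R) R, ENNReal.ofReal (u x * tanSlope q k c R ρ x) ≤
      ∫⁻ x in Set.Ioc (-R) R, ENNReal.ofReal (|u' x| * |Real.tan (angle q R ρ x)|) := by
  have hle : -R ≤ R := by linarith
  have hucont : Continuous u := continuous_iff_continuousAt.2 fun t => (hu t).continuousAt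
  have hac := continuous_angle (R := R) hq hρ
  have hcos := fun {x} (hx : x ∈ Set.Icc (-R) R) => cos_angle_pos hq hΘ hρ hρ0 hx
  have hTd : ∀ x ∈ Set.uIcc (-R) R, HasDerivAt (fun x => Real.tan (angle q R ρ x))
      (tanSlope q k c R ρ x) x := fun x hx => by
    rw [Set.uIcc_of_le hle] at hx
    exact (Real.hasDerivAt_tan (hcos hx).ne').comp x (hasDerivAt_angle hq hρ hρ0 hx)
  have hTc : ContinuousOn (fun x => Real.tan (angle q R ρ x)) (Set.uIcc (-R) R) :=
    fun x hx => (hTd x hx).continuousAt.continuousWithinAt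
  have hsc : ContinuousOn (tanSlope q k c R ρ) (Set.uIcc (-R) R) := by
    rw [Set.uIcc_of_le hle]
    unfold tanSlope
    refine ContinuousOn.mul (ContinuousOn.div (by fun_prop) (by fun_prop)
      fun x hx => (pow_pos (hcos hx) 2).ne') (ContinuousOn.mul (ContinuousOn.div (by fun_prop)
      (by fun_prop) fun x hx => (pow_pos (hcos hx) k).ne') (by fun_prop))
  have hibp := intervalIntegral.integral_mul_deriv_eq_deriv_mul (fun x _ => hu x) hTd
    (hu'.intervalIntegrable _ _) hsc.intervalIntegrable
  rw [hul, hur] at hibp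
  have i1 : IntervalIntegrable (fun x => u x * tanSlope q k c R ρ x) volume (-R) R :=
    (hucont.continuousOn.mul hsc).intervalIntegrable
  have i2 : IntervalIntegrable (fun x => |u' x| * |Real.tan (angle q R ρ x)|) volume (-R) R :=
    (hu'.abs.continuousOn.mul hTc.abs).intervalIntegrable
  have i3 : IntervalIntegrable (fun x => u' x * Real.tan (angle q R ρ x)) volume (-R) R :=
    (hu'.continuousOn.mul hTc).intervalIntegrable
  rw [intervalIntegrable_iff_integrableOn_Ioc_of_le hle] at i1 i2
  rw [← ofReal_integral_eq_lintegral_ofReal i1, ← ofReal_integral_eq_lintegral_ofReal i2]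
  · apply ENNReal.ofReal_le_ofReal
    rw [← intervalIntegral.integral_of_le hle, ← intervalIntegral.integral_of_le hle, hibp]
    simp only [zero_mul, sub_zero, zero_sub]
    rw [← intervalIntegral.integral_neg]
    apply intervalIntegral.integral_mono_on hle i3.neg
      ((intervalIntegrable_iff_integrableOn_Ioc_of_le hle).2 i2)
    intro x _
    rw [← abs_mul]
    exact neg_le_abs _
  · exact Filter.Eventually.of_forall fun x => by positivity
  · refine (ae_restrict_iff' measurableSet_Ioc).2 (Filter.Eventually.of_forall fun x hx => ?_)
    exact mul_nonneg (hu0 x) (tanSlope_nonneg hq hΘ hc hR hρ hρ0 ⟨hx.1.le, hx.2⟩)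

end Angle

lemma lintegral_div_cos_angle {k : ℕ} {Θ c R : ℝ} {q ρ : ℝ → ℝ}
    (hq : IsCosQuantile (k + 2) Θ c q) (hΘ : Θ < Real.pi / 2)
    (hc : 0 < c) (hR : 0 < R) (hρ : Continuous ρ) (hρ0 : ∀ x, 0 ≤ ρ x) {s : ℝ} (hs : 0 ≤ s) :
    ∫⁻ x in Set.Ioc (-R) R, ENNReal.ofReal (s * (ρ x / Real.cos (angle q R ρ x) ^ 2)) =
      ENNReal.ofReal
        (s * ((∫ x in (-R)..R, ρ x) * ((∫ t in (-Θ)..Θ, Real.cos t ^ k) / c))) := by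
  have hle : -R ≤ R := by linarith
  have hac := continuous_angle (R := R) hq hρ
  have hi : IntervalIntegrable (fun x => s * (ρ x / Real.cos (angle q R ρ x) ^ 2))
      volume (-R) R := by
    apply ContinuousOn.intervalIntegrable
    rw [Set.uIcc_of_le hle]
    exact continuousOn_const.mul (ContinuousOn.div hρ.continuousOn (by fun_prop)
      fun x hx => (pow_pos (cos_angle_pos hq hΘ hρ hρ0 hx) 2).ne')
  rw [intervalIntegrable_iff_integrableOn_Ioc_of_le hle] at hi
  rw [← integral_div_cos_angle hq hΘ hc hR hρ hρ0, ← intervalIntegral.integral_const_mul,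
    intervalIntegral.integral_of_le hle, ofReal_integral_eq_lintegral_ofReal hi]
  exact Filter.Eventually.of_forall fun x => mul_nonneg hs (div_nonneg (hρ0 x) (sq_nonneg _))

lemma setLIntegral_cube (s : Set ℝ) (g : ℝ × ℝ × ℝ → ℝ≥0∞) (hg : Measurable g) :
    ∫⁻ p in s ×ˢ s ×ˢ s, g p = ∫⁻ x in s, ∫⁻ y in s, ∫⁻ z in s, g (x, y, z) := by
  rw [Measure.volume_eq_prod, ← Measure.prod_restrict, lintegral_prod _ hg.aemeasurable]
  congr 1
  ext x
  rw [Measure.volume_eq_prod, ← Measure.prod_restrict, lintegral_prod]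
  exact (hg.comp (by fun_prop)).aemeasurable

lemma setLIntegral_cube_swap_right (s : Set ℝ) (g : ℝ × ℝ × ℝ → ℝ≥0∞) (hg : Measurable g) :
    ∫⁻ p in s ×ˢ s ×ˢ s, g p = ∫⁻ x in s, ∫⁻ z in s, ∫⁻ y in s, g (x, y, z) := by
  rw [setLIntegral_cube s g hg]
  congr 1
  ext x
  rw [lintegral_lintegral_swap]
  exact (hg.comp (by fun_prop : Measurable fun w : ℝ × ℝ => (x, w.1, w.2))).aemeasurable

lemma setLIntegral_cube_swap_left (s : Set ℝ) (g : ℝ × ℝ × ℝ → ℝ≥0∞) (hg : Measurable g) :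
    ∫⁻ p in s ×ˢ s ×ˢ s, g p = ∫⁻ w in s ×ˢ s, ∫⁻ x in s, g (x, w.1, w.2) := by
  rw [Measure.volume_eq_prod, ← Measure.prod_restrict, lintegral_prod_symm _ hg.aemeasurable]

lemma prod_le_sum_pow_three {a b c : ℝ} (ha : 0 ≤ a) (hb : 0 ≤ b) (hc : 0 ≤ c) :
    27 * (a * b * c) ≤ (a + b + c) ^ 3 := by
  nlinarith [mul_nonneg ha (sq_nonneg (b - c)), mul_nonneg hb (sq_nonneg (a - c)),
    mul_nonneg hc (sq_nonneg (a - b)), mul_nonneg ha (sq_nonneg (a - c)),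
    mul_nonneg ha (sq_nonneg (a - b)), mul_nonneg hb (sq_nonneg (a - b)),
    mul_nonneg hb (sq_nonneg (b - c)), mul_nonneg hc (sq_nonneg (a - c)),
    mul_nonneg hc (sq_nonneg (b - c))]

/-- The arithmetic-geometric mean inequality for the diagonal of the Jacobian of the
triangular transport map. -/
lemma jacobian_amgm {a F1 F2 M cα cβ cγ c2 c3 c4 κ : ℝ} (ha : 0 ≤ a) (hF1 : 0 ≤ F1)
    (hF2 : 0 ≤ F2) (h1 : F1 = 0 → F2 = 0) (h2 : F2 = 0 → a ^ 6 = 0) (hM : 0 < M)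
    (hα : 0 < cα) (hβ : 0 < cβ) (hγ : 0 < cγ) (hc2 : 0 < c2) (hc3 : 0 < c3) (hc4 : 0 < c4)
    (hκ : 0 < κ) (hκ3 : κ ^ 3 = M / (c2 * c3 * c4)) :
    a ^ 6 / (cα ^ 2 * cβ ^ 2 * cγ ^ 2) ≤ κ / 3 *
      (a ^ 4 * (1 / cα ^ 2 * (c2 / cα ^ 2 * (F1 / M))) +
       a ^ 4 * (1 / cα * (1 / cβ ^ 2 * (c3 / cβ ^ 3 * (F2 / F1)))) +
       a ^ 4 * (1 / (cα * cβ) * (1 / cγ ^ 2 * (c4 / cγ ^ 4 * (a ^ 6 / F2))))) := by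
  rcases ha.eq_or_lt with h0 | h0
  · simp [← h0]
  have hF2' : 0 < F2 := lt_of_le_of_ne hF2 fun h => (pow_pos h0 6).ne' (h2 h.symm)
  have hF1' : 0 < F1 := lt_of_le_of_ne hF1 fun h => hF2'.ne' (h1 h.symm)
  rw [← mul_add, ← mul_add]
  have hp1 : 0 ≤ 1 / cα ^ 2 * (c2 / cα ^ 2 * (F1 / M)) := by positivity
  have hp2 : 0 ≤ 1 / cα * (1 / cβ ^ 2 * (c3 / cβ ^ 3 * (F2 / F1))) := by positivity
  have hp3 : 0 ≤ 1 / (cα * cβ) * (1 / cγ ^ 2 * (c4 / cγ ^ 4 * (a ^ 6 / F2))) := by positivity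
  have key := prod_le_sum_pow_three hp1 hp2 hp3
  have hprod : (1 / cα ^ 2 * (c2 / cα ^ 2 * (F1 / M))) *
      (1 / cα * (1 / cβ ^ 2 * (c3 / cβ ^ 3 * (F2 / F1)))) *
      (1 / (cα * cβ) * (1 / cγ ^ 2 * (c4 / cγ ^ 4 * (a ^ 6 / F2)))) =
      (c2 * c3 * c4) / M * (a ^ 6 / (cα ^ 2 * cβ ^ 2 * cγ ^ 2) ^ 3) := by
    field_simp
  rw [hprod] at key
  refine le_of_pow_le_pow_left₀ (n := 3) (by norm_num) (by positivity) ?_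
  rw [mul_pow, mul_pow, div_pow κ, hκ3]
  calc (a ^ 6 / (cα ^ 2 * cβ ^ 2 * cγ ^ 2)) ^ 3
      = M / (c2 * c3 * c4) / 3 ^ 3 * ((a ^ 4) ^ 3 *
        (27 * ((c2 * c3 * c4) / M * (a ^ 6 / (cα ^ 2 * cβ ^ 2 * cγ ^ 2) ^ 3)))) := by
        field_simp
        norm_num
    _ ≤ _ := by gcongr

lemma tan_sq_sum {α β γ : ℝ} (hα : 0 < Real.cos α) (hβ : 0 < Real.cos β)
    (hγ : 0 < Real.cos γ) :
    Real.tan α ^ 2 + (1 / Real.cos α * Real.tan β) ^ 2 +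
      (1 / (Real.cos α * Real.cos β) * Real.tan γ) ^ 2 =
      1 / (Real.cos α ^ 2 * Real.cos β ^ 2 * Real.cos γ ^ 2) - 1 := by
  simp only [Real.tan_eq_sin_div_cos]
  field_simp
  rw [Real.sin_sq α, Real.sin_sq β, Real.sin_sq γ]
  ring

/-- Pointwise Cauchy–Schwarz and Young inequality. -/
lemma young_sum {a l u1 u2 u3 g1 g2 g3 t1 t2 t3 : ℝ} (hl : 0 < l)
    (h1 : |u1| ≤ 4 * a ^ 3 * g1) (h2 : |u2| ≤ 4 * a ^ 3 * g2) (h3 : |u3| ≤ 4 * a ^ 3 * g3) :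
    |u1| * |t1| + |u2| * |t2| + |u3| * |t3| ≤
      2 * l * (g1 ^ 2 + g2 ^ 2 + g3 ^ 2) + 2 / l * (a ^ 6 * (t1 ^ 2 + t2 ^ 2 + t3 ^ 2)) := by
  have key : ∀ u g t : ℝ, |u| ≤ 4 * a ^ 3 * g →
      |u| * |t| ≤ 2 * l * g ^ 2 + 2 / l * (a ^ 6 * t ^ 2) := by
    intro u g t h
    have e : 2 * l * g ^ 2 + 2 / l * (a ^ 6 * t ^ 2) - 4 * a ^ 3 * g * |t| =
        2 / l * (l * g - a ^ 3 * |t|) ^ 2 := by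
      rw [← sq_abs t]
      field_simp
      ring
    have : 0 ≤ 2 / l * (l * g - a ^ 3 * |t|) ^ 2 := by positivity
    have := mul_le_mul_of_nonneg_right h (abs_nonneg t)
    linarith
  have := key u1 g1 t1 h1
  have := key u2 g2 t2 h2
  have := key u3 g3 t3 h3
  linarith

lemma sq_le_of_forall_pos {X A B : ℝ} (hA : 0 ≤ A) (hB : 0 ≤ B) (hX : 0 ≤ X)
    (h : ∀ l : ℝ, 0 < l → X ≤ l * A + B / l) : X ^ 2 ≤ 4 * A * B := by
  have := discrim_le_zero (a := A) (b := -X) (c := B) fun l => by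
    rcases lt_or_ge 0 l with hl | hl
    · have := mul_le_mul_of_nonneg_right (h l hl) hl.le
      rw [add_mul, div_mul_cancel₀ _ hl.ne'] at this
      linarith
    · nlinarith [mul_nonneg hA (mul_self_nonneg l)]
  unfold discrim at this
  linarith

/-- The integral of `cos ^ k` over `[-Θ, Θ]`. -/
def cosMass (k : ℕ) (Θ : ℝ) : ℝ := ∫ t in (-Θ)..Θ, Real.cos t ^ k

lemma cosMass_pos (k : ℕ) {Θ : ℝ} (h0 : 0 < Θ) (h1 : Θ < Real.pi / 2) : 0 < cosMass k Θ := by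
  apply intervalIntegral.intervalIntegral_pos_of_pos_on
    (Continuous.intervalIntegrable (by fun_prop) _ _) _ (by linarith)
  intro t ht
  exact pow_pos (Real.cos_pos_of_mem_Ioo ⟨by linarith [ht.1], by linarith [ht.2]⟩) k

lemma measurable_angle {X : Type*} [TopologicalSpace X] [MeasurableSpace X]
    [FirstCountableTopology X] [OpensMeasurableSpace (X × ℝ)] {q : ℝ → ℝ} (hq : Continuous q)
    (R : ℝ) {ρ : X → ℝ → ℝ} (hρ : Continuous fun p : X × ℝ => ρ p.1 p.2) :
    Measurable fun p : X × ℝ => angle q R (ρ p.1) p.2 := by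
  have hρ' : Continuous fun w : (X × ℝ) × ℝ => ρ w.1.1 w.2 :=
    hρ.comp (by fun_prop : Continuous fun w : (X × ℝ) × ℝ => (w.1.1, w.2))
  have h1 : Continuous fun p : X × ℝ => ∫ t in (-R)..p.2, ρ p.1 t :=
    intervalIntegral.continuous_parametric_intervalIntegral_of_continuous
      (f := fun (p : X × ℝ) z => ρ p.1 z) hρ' continuous_snd
  have h2 : Continuous fun p : X × ℝ => ∫ t in (-R)..R, ρ p.1 t :=
    intervalIntegral.continuous_parametric_intervalIntegral_of_continuous'
      (f := fun (p : X × ℝ) z => ρ p.1 z) hρ' _ _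
  have h := h1.measurable.div h2.measurable
  exact hq.measurable.comp h

set_option maxHeartbeats 400000 in
lemma sobolev_cube_bound {a g1 g2 g3 u1 u2 u3 : ℝ × ℝ × ℝ → ℝ} {R M N Θ : ℝ} (hR : 0 < R)
    (hΘ0 : 0 < Θ) (hΘ : Θ < Real.pi / 2) (ha : Continuous a) (ha0 : ∀ p, 0 ≤ a p)
    (hsupp : ∀ x y z, (R ≤ |x| ∨ R ≤ |y| ∨ R ≤ |z|) → a (x, y, z) = 0)
    (hu1 : ∀ x y z, HasDerivAt (fun t => a (t, y, z) ^ 4) (u1 (x, y, z)) x)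
    (hu2 : ∀ x y z, HasDerivAt (fun t => a (x, t, z) ^ 4) (u2 (x, y, z)) y)
    (hu3 : ∀ x y z, HasDerivAt (fun t => a (x, y, t) ^ 4) (u3 (x, y, z)) z)
    (hc1 : Continuous u1) (hc2 : Continuous u2) (hc3 : Continuous u3)
    (hg1 : Continuous g1) (hg2 : Continuous g2) (hg3 : Continuous g3)
    (hb1 : ∀ p, |u1 p| ≤ 4 * a p ^ 3 * g1 p) (hb2 : ∀ p, |u2 p| ≤ 4 * a p ^ 3 * g2 p)
    (hb3 : ∀ p, |u3 p| ≤ 4 * a p ^ 3 * g3 p) (hM : 0 < M) (hN : 0 ≤ N)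
    (hMa : ∫⁻ p in Set.Ioc (-R) R ×ˢ Set.Ioc (-R) R ×ˢ Set.Ioc (-R) R,
      ENNReal.ofReal (a p ^ 6) = ENNReal.ofReal M)
    (hNg : ∫⁻ p in Set.Ioc (-R) R ×ˢ Set.Ioc (-R) R ×ˢ Set.Ioc (-R) R,
      ENNReal.ofReal (g1 p ^ 2 + g2 p ^ 2 + g3 p ^ 2) ≤ ENNReal.ofReal N) :
    M * (cosMass 0 Θ * cosMass 1 Θ * cosMass 2 Θ) ^ 6 * (cosMass 2 Θ * cosMass 3 Θ * cosMass 4 Θ) ^ 2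
      ≤ (16 / 9) ^ 3 * N ^ 3 * (cosMass 0 Θ * cosMass 1 Θ * cosMass 2 Θ -
        cosMass 2 Θ * cosMass 3 Θ * cosMass 4 Θ) ^ 3 *
          (cosMass 2 Θ * cosMass 3 Θ * cosMass 4 Θ) ^ 3 := by
  have hle : -R ≤ R := by linarith
  obtain ⟨q2, hq2⟩ := exists_isCosQuantile 2 Θ hΘ0 hΘ
  obtain ⟨q3, hq3⟩ := exists_isCosQuantile 3 Θ hΘ0 hΘ
  obtain ⟨q4, hq4⟩ := exists_isCosQuantile 4 Θ hΘ0 hΘ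
  have p0 := cosMass_pos 0 hΘ0 hΘ
  have p1 := cosMass_pos 1 hΘ0 hΘ
  have p2 := cosMass_pos 2 hΘ0 hΘ
  have p3 := cosMass_pos 3 hΘ0 hΘ
  have p4 := cosMass_pos 4 hΘ0 hΘ
  change IsCosQuantile 2 Θ (cosMass 2 Θ) q2 at hq2
  change IsCosQuantile 3 Θ (cosMass 3 Θ) q3 at hq3
  change IsCosQuantile 4 Θ (cosMass 4 Θ) q4 at hq4
  set I := Set.Ioc (-R) R with hI
  have hIcc : ∀ {x}, x ∈ I → x ∈ Set.Icc (-R) R := fun hx => ⟨hx.1.le, hx.2⟩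
  obtain ⟨F, hF⟩ : ∃ F : ℝ → ℝ → ℝ → ℝ, ∀ x y z, F x y z = a (x, y, z) ^ 6 :=
    ⟨_, fun _ _ _ => rfl⟩
  obtain ⟨F2, hF2⟩ : ∃ F2 : ℝ → ℝ → ℝ, ∀ x y, F2 x y = ∫ z in (-R)..R, F x y z :=
    ⟨_, fun _ _ => rfl⟩
  obtain ⟨F1, hF1⟩ : ∃ F1 : ℝ → ℝ, ∀ x, F1 x = ∫ y in (-R)..R, F2 x y := ⟨_, fun _ => rfl⟩
  have cF : Continuous fun p : ℝ × ℝ × ℝ => F p.1 p.2.1 p.2.2 := by simp only [hF]; fun_prop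
  have cF' : Continuous fun w : (ℝ × ℝ) × ℝ => F w.1.1 w.1.2 w.2 := by
    simp only [hF]; fun_prop
  have cF2 : Continuous fun p : ℝ × ℝ => F2 p.1 p.2 := by
    simp only [hF2]
    exact intervalIntegral.continuous_parametric_intervalIntegral_of_continuous'
      (f := fun (p : ℝ × ℝ) z => F p.1 p.2 z) cF' _ _
  have cF1 : Continuous F1 := by
    rw [funext hF1]
    exact intervalIntegral.continuous_parametric_intervalIntegral_of_continuous' cF2 _ _
  have nF : ∀ x y z, 0 ≤ F x y z := fun x y z => by rw [hF]; exact pow_nonneg (ha0 _) 6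
  have nF2 : ∀ x y, 0 ≤ F2 x y := fun x y => by
    rw [hF2]; exact intervalIntegral.integral_nonneg hle fun _ _ => nF _ _ _
  have nF1 : ∀ x, 0 ≤ F1 x := fun x => by
    rw [hF1]; exact intervalIntegral.integral_nonneg hle fun _ _ => nF2 _ _
  have cFz : ∀ x y, Continuous (F x y) := fun x y => by
    rw [funext (hF x y)]; fun_prop
  have cF2y : ∀ x, Continuous (F2 x) := fun x => cF2.comp (Continuous.prodMk_right x)
  obtain ⟨α, hα⟩ : ∃ α : ℝ → ℝ, ∀ x, α x = angle q2 R F1 x := ⟨_, fun _ => rfl⟩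
  obtain ⟨β, hβ⟩ : ∃ β : ℝ → ℝ → ℝ, ∀ x y, β x y = angle q3 R (F2 x) y := ⟨_, fun _ _ => rfl⟩
  obtain ⟨γ, hγ⟩ : ∃ γ : ℝ → ℝ → ℝ → ℝ, ∀ x y z, γ x y z = angle q4 R (F x y) z :=
    ⟨_, fun _ _ _ => rfl⟩
  have cα : ∀ {x}, x ∈ I → 0 < Real.cos (α x) := fun hx => by
    rw [hα]; exact cos_angle_pos hq2 hΘ cF1 nF1 (hIcc hx)
  have cβ : ∀ x {y}, y ∈ I → 0 < Real.cos (β x y) := fun x y hy => by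
    rw [hβ]; exact cos_angle_pos hq3 hΘ (cF2y x) (nF2 x) (hIcc hy)
  have cγ : ∀ x y {z}, z ∈ I → 0 < Real.cos (γ x y z) := fun x y z hz => by
    rw [hγ]; exact cos_angle_pos hq4 hΘ (cFz x y) (nF x y) (hIcc hz)
  have mα : Measurable α := by
    rw [funext hα]; exact (continuous_angle hq2 cF1).measurable
  have mβ : Measurable fun p : ℝ × ℝ => β p.1 p.2 := by
    simp only [hβ]; exact measurable_angle hq3.continuous R cF2
  have mγ : Measurable fun p : ℝ × ℝ × ℝ => γ p.1 p.2.1 p.2.2 := by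
    have h := measurable_angle hq4.continuous R (ρ := fun (p : ℝ × ℝ) z => F p.1 p.2 z) cF'
    have m : Measurable fun p : ℝ × ℝ × ℝ => ((p.1, p.2.1), p.2.2) := by fun_prop
    simp only [hγ]
    exact h.comp m
  have mα' : Measurable fun p : ℝ × ℝ × ℝ => α p.1 := mα.comp measurable_fst
  have mβ' : Measurable fun p : ℝ × ℝ × ℝ => β p.1 p.2.1 :=
    mβ.comp (by fun_prop : Measurable fun p : ℝ × ℝ × ℝ => (p.1, p.2.1))
  have mF1' : Measurable fun p : ℝ × ℝ × ℝ => F1 p.1 := cF1.measurable.comp measurable_fst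
  have mF2' : Measurable fun p : ℝ × ℝ × ℝ => F2 p.1 p.2.1 :=
    cF2.measurable.comp (by fun_prop : Measurable fun p : ℝ × ℝ × ℝ => (p.1, p.2.1))
  have mF' := cF.measurable
  have ma := ha.measurable
  -- total mass
  have hMass : ∫ x in (-R)..R, F1 x = M := by
    rw [setLIntegral_cube _ _ (by fun_prop)] at hMa
    have e3 : ∀ x y, ∫⁻ z in I, ENNReal.ofReal (F x y z) = ENNReal.ofReal (F2 x y) := by
      intro x y
      rw [hF2, ← ofReal_integral_eq_lintegral_ofReal, ← intervalIntegral.integral_of_le hle]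
      · exact (intervalIntegrable_iff_integrableOn_Ioc_of_le hle).1
          ((cFz x y).intervalIntegrable _ _)
      · exact Filter.Eventually.of_forall fun z => nF x y z
    have e2 : ∀ x, ∫⁻ y in I, ENNReal.ofReal (F2 x y) = ENNReal.ofReal (F1 x) := by
      intro x
      rw [hF1, ← ofReal_integral_eq_lintegral_ofReal, ← intervalIntegral.integral_of_le hle]
      · exact (intervalIntegrable_iff_integrableOn_Ioc_of_le hle).1
          ((cF2y x).intervalIntegrable _ _)
      · exact Filter.Eventually.of_forall fun z => nF2 x z
    have e1 : ∫⁻ x in I, ENNReal.ofReal (F1 x) = ENNReal.ofReal (∫ x in (-R)..R, F1 x) := by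
      rw [← ofReal_integral_eq_lintegral_ofReal, ← intervalIntegral.integral_of_le hle]
      · exact (intervalIntegrable_iff_integrableOn_Ioc_of_le hle).1
          (cF1.intervalIntegrable _ _)
      · exact Filter.Eventually.of_forall fun z => nF1 z
    simp only [← hF, e3, e2, e1] at hMa
    exact (ENNReal.ofReal_eq_ofReal_iff
      (intervalIntegral.integral_nonneg hle fun x _ => nF1 x) hM.le).1 hMa
  -- transported second moment
  set r2 := cosMass 0 Θ / cosMass 2 Θ with hr2
  set r3 := cosMass 1 Θ / cosMass 3 Θ with hr3
  set r4 := cosMass 2 Θ / cosMass 4 Θ with hr4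
  set P : ℝ × ℝ × ℝ → ℝ := fun p => a p ^ 6 /
    (Real.cos (α p.1) ^ 2 * Real.cos (β p.1 p.2.1) ^ 2 * Real.cos (γ p.1 p.2.1 p.2.2) ^ 2)
    with hP
  have mP : Measurable P := by fun_prop
  have hPint : ∫⁻ p in I ×ˢ I ×ˢ I, ENNReal.ofReal (P p) =
      ENNReal.ofReal (M * (r2 * r3 * r4)) := by
    rw [setLIntegral_cube _ _ (by fun_prop)]
    have e3 : ∀ x y, ∫⁻ z in I, ENNReal.ofReal (P (x, y, z)) = ENNReal.ofReal
        (1 / (Real.cos (α x) ^ 2 * Real.cos (β x y) ^ 2) * (F2 x y * r4)) := by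
      intro x y
      rw [hr4, cosMass, hF2, ← lintegral_div_cos_angle hq4 hΘ p4 hR (cFz x y) (nF x y) (by positivity)]
      congr 1
      ext z
      congr 1
      simp only [hP, ← hF, ← hγ]
      rw [div_mul_div_comm, one_mul]
    have e2 : ∀ x, ∫⁻ y in I, ENNReal.ofReal
        (1 / (Real.cos (α x) ^ 2 * Real.cos (β x y) ^ 2) * (F2 x y * r4)) =
        ENNReal.ofReal (r4 / Real.cos (α x) ^ 2 * (F1 x * r3)) := by
      intro x
      rw [hr3, cosMass, hF1, ← lintegral_div_cos_angle hq3 hΘ p3 hR (cF2y x) (nF2 x) (by positivity)]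
      congr 1
      ext y
      congr 1
      rw [← hβ]
      ring
    have e1 : ∫⁻ x in I, ENNReal.ofReal (r4 / Real.cos (α x) ^ 2 * (F1 x * r3)) =
        ENNReal.ofReal ((r3 * r4) * (M * r2)) := by
      rw [hr2, cosMass, ← hMass,
        ← lintegral_div_cos_angle hq2 hΘ p2 hR cF1 nF1 (by positivity)]
      congr 1
      ext x
      congr 1
      rw [← hα]
      ring
    simp only [e3, e2, e1]
    congr 1
    ring
  -- derivatives of the transport map
  have hs1 : ∀ x, tanSlope q2 2 (cosMass 2 Θ) R F1 x = 1 / Real.cos (α x) ^ 2 *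
      (cosMass 2 Θ / Real.cos (α x) ^ 2 * (F1 x / M)) := fun x => by
    rw [tanSlope, hα, hMass]
  have hs2 : ∀ x y, tanSlope q3 3 (cosMass 3 Θ) R (F2 x) y = 1 / Real.cos (β x y) ^ 2 *
      (cosMass 3 Θ / Real.cos (β x y) ^ 3 * (F2 x y / F1 x)) := fun x y => by
    rw [tanSlope, hβ, hF1]
  have hs3 : ∀ x y z, tanSlope q4 4 (cosMass 4 Θ) R (F x y) z = 1 / Real.cos (γ x y z) ^ 2 *
      (cosMass 4 Θ / Real.cos (γ x y z) ^ 4 * (a (x, y, z) ^ 6 / F2 x y)) := fun x y z => by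
    rw [tanSlope, hγ, hF2, ← hF]
  set d1 : ℝ × ℝ × ℝ → ℝ := fun p => a p ^ 4 * tanSlope q2 2 (cosMass 2 Θ) R F1 p.1 with hd1
  set d2 : ℝ × ℝ × ℝ → ℝ := fun p => a p ^ 4 *
    (1 / Real.cos (α p.1) * tanSlope q3 3 (cosMass 3 Θ) R (F2 p.1) p.2.1) with hd2
  set d3 : ℝ × ℝ × ℝ → ℝ := fun p => a p ^ 4 *
    (1 / (Real.cos (α p.1) * Real.cos (β p.1 p.2.1)) *
      tanSlope q4 4 (cosMass 4 Θ) R (F p.1 p.2.1) p.2.2) with hd3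
  set t1 : ℝ × ℝ × ℝ → ℝ := fun p => Real.tan (α p.1) with ht1
  set t2 : ℝ × ℝ × ℝ → ℝ := fun p => 1 / Real.cos (α p.1) * Real.tan (β p.1 p.2.1) with ht2
  set t3 : ℝ × ℝ × ℝ → ℝ := fun p => 1 / (Real.cos (α p.1) * Real.cos (β p.1 p.2.1)) *
    Real.tan (γ p.1 p.2.1 p.2.2) with ht3
  have md1 : Measurable d1 := by simp only [hd1, hs1]; fun_prop
  have md2 : Measurable d2 := by simp only [hd2, hs2]; fun_prop
  have md3 : Measurable d3 := by simp only [hd3, hs3]; fun_prop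
  have mtan : Measurable Real.tan := by
    have : Real.tan = fun x => Real.sin x / Real.cos x := funext Real.tan_eq_sin_div_cos
    rw [this]
    exact Real.measurable_sin.div Real.measurable_cos
  have mt1 : Measurable t1 := mtan.comp mα'
  have mt2 : Measurable t2 := (measurable_const.div (Real.measurable_cos.comp mα')).mul
    (mtan.comp mβ')
  have mt3 : Measurable t3 := (measurable_const.div ((Real.measurable_cos.comp mα').mul
    (Real.measurable_cos.comp mβ'))).mul (mtan.comp mγ)
  have mu1 := hc1.measurable
  have mu2 := hc2.measurable
  have mu3 := hc3.measurable
  have mg1 := hg1.measurable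
  have mg2 := hg2.measurable
  have mg3 := hg3.measurable
  have habsR : R ≤ |R| := le_abs_self R
  have habsR' : R ≤ |(-R)| := by rw [abs_neg]; exact habsR
  have scale : ∀ {k : ℕ} {c s : ℝ} {q ρ u u' : ℝ → ℝ}, IsCosQuantile k Θ c q → 0 < c → 0 ≤ s →
      Continuous ρ → (∀ x, 0 ≤ ρ x) → (∀ x, HasDerivAt u (u' x) x) → Continuous u' →
      (∀ x, 0 ≤ u x) → u (-R) = 0 → u R = 0 →
      ∫⁻ x in I, ENNReal.ofReal (u x * (s * tanSlope q k c R ρ x)) ≤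
      ∫⁻ x in I, ENNReal.ofReal (|u' x| * |s * Real.tan (angle q R ρ x)|) := by
    intro k c s q ρ u u' hq hc hs hρ hρ0 hu hu' hu0 hl hr
    have h := lintegral_mul_tanSlope_le hq hΘ hc hR hρ hρ0 hu hu' hu0 hl hr
    have h' := mul_le_mul_right h (ENNReal.ofReal s)
    rw [← lintegral_const_mul' _ _ ENNReal.ofReal_ne_top,
      ← lintegral_const_mul' _ _ ENNReal.ofReal_ne_top] at h'
    refine le_trans (le_of_eq ?_) (h'.trans (le_of_eq ?_))
    · congr 1
      ext x
      rw [← ENNReal.ofReal_mul hs]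
      congr 1
      ring
    · congr 1
      ext x
      rw [← ENNReal.ofReal_mul hs, abs_mul s, abs_of_nonneg hs]
      congr 1
      ring
  have hd1le : ∫⁻ p in I ×ˢ I ×ˢ I, ENNReal.ofReal (d1 p) ≤
      ∫⁻ p in I ×ˢ I ×ˢ I, ENNReal.ofReal (|u1 p| * |t1 p|) := by
    rw [setLIntegral_cube_swap_left _ _ (by fun_prop),
      setLIntegral_cube_swap_left _ _ (by fun_prop)]
    apply lintegral_mono
    intro w
    have := scale (s := 1) hq2 p2 zero_le_one cF1 nF1 (fun x => hu1 x w.1 w.2)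
      (hc1.comp (by fun_prop : Continuous fun x : ℝ => (x, w.1, w.2)))
      (fun x => pow_nonneg (ha0 _) 4) (by simp [hsupp _ _ _ (Or.inl habsR')])
      (by simp [hsupp _ _ _ (Or.inl habsR)])
    simpa only [one_mul, hd1, ht1, hα] using this
  have hd2le : ∫⁻ p in I ×ˢ I ×ˢ I, ENNReal.ofReal (d2 p) ≤
      ∫⁻ p in I ×ˢ I ×ˢ I, ENNReal.ofReal (|u2 p| * |t2 p|) := by
    rw [setLIntegral_cube_swap_right _ _ (by fun_prop),
      setLIntegral_cube_swap_right _ _ (by fun_prop)]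
    apply setLIntegral_mono' measurableSet_Ioc
    intro x hx
    apply lintegral_mono
    intro z
    have := cα hx
    have key := scale (s := 1 / Real.cos (α x)) hq3 p3 (by positivity) (cF2y x) (nF2 x) (fun y => hu2 x y z)
      (hc2.comp (by fun_prop : Continuous fun y : ℝ => (x, y, z)))
      (fun x => pow_nonneg (ha0 _) 4) (by simp [hsupp _ _ _ (Or.inr (Or.inl habsR'))])
      (by simp [hsupp _ _ _ (Or.inr (Or.inl habsR))])
    simpa only [hd2, ht2, hβ] using key
  have hd3le : ∫⁻ p in I ×ˢ I ×ˢ I, ENNReal.ofReal (d3 p) ≤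
      ∫⁻ p in I ×ˢ I ×ˢ I, ENNReal.ofReal (|u3 p| * |t3 p|) := by
    rw [setLIntegral_cube _ _ (by fun_prop), setLIntegral_cube _ _ (by fun_prop)]
    apply setLIntegral_mono' measurableSet_Ioc
    intro x hx
    apply setLIntegral_mono' measurableSet_Ioc
    intro y hy
    have := cα hx
    have := cβ x hy
    have key := scale (s := 1 / (Real.cos (α x) * Real.cos (β x y))) hq4 p4 (by positivity) (cFz x y) (nF x y) (fun z => hu3 x y z)
      (hc3.comp (by fun_prop : Continuous fun z : ℝ => (x, y, z)))
      (fun x => pow_nonneg (ha0 _) 4) (by simp [hsupp _ _ _ (Or.inr (Or.inr habsR'))])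
      (by simp [hsupp _ _ _ (Or.inr (Or.inr habsR))])
    simpa only [hd3, ht3, hγ] using key
  set A := r2 * r3 * r4 with hA
  set c := cosMass 2 Θ * cosMass 3 Θ * cosMass 4 Θ with hc
  have hcpos : 0 < c := by positivity
  have hcA : c * A = cosMass 0 Θ * cosMass 1 Θ * cosMass 2 Θ := by
    rw [hc, hA, hr2, hr3, hr4]
    field_simp
  set κ := (M / c) ^ ((1 : ℝ) / 3) with hκ
  have hκpos : 0 < κ := by positivity
  have hκ3 : κ ^ 3 = M / c := by
    rw [hκ, ← Real.rpow_natCast, ← Real.rpow_mul (by positivity)]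
    norm_num
  have hcube : MeasurableSet (I ×ˢ I ×ˢ I) :=
    measurableSet_Ioc.prod (measurableSet_Ioc.prod measurableSet_Ioc)
  have ptAM : ∀ p ∈ I ×ˢ I ×ˢ I, P p ≤ κ / 3 * (d1 p + d2 p + d3 p) := by
    rintro ⟨x, y, z⟩ ⟨hx, hy, hz⟩
    simp only [hP, hd1, hd2, hd3, hs1, hs2, hs3]
    refine jacobian_amgm (ha0 _) (nF1 x) (nF2 x y) (fun h => ?_) (fun h => ?_) hM (cα hx)
      (cβ x hy) (cγ x y hz) p2 p3 p4 hκpos hκ3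
    · exact eq_zero_of_integral_eq_zero hR (cF2y x) (nF2 x) (by rw [← hF1, h]) (hIcc hy)
    · rw [← hF]
      exact eq_zero_of_integral_eq_zero hR (cFz x y) (nF x y) (by rw [← hF2, h]) (hIcc hz)
  set V : ℝ × ℝ × ℝ → ℝ := fun p => P p - a p ^ 6 with hV
  have hV' : ∀ p ∈ I ×ˢ I ×ˢ I, V p = a p ^ 6 * (t1 p ^ 2 + t2 p ^ 2 + t3 p ^ 2) := by
    rintro ⟨x, y, z⟩ ⟨hx, hy, hz⟩
    simp only [hV, ht1, ht2, ht3, hP]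
    rw [tan_sq_sum (cα hx) (cβ x hy) (cγ x y hz)]
    ring
  have hVnonneg : ∀ p ∈ I ×ˢ I ×ˢ I, 0 ≤ V p := fun p hp => by
    rw [hV' p hp]
    have := ha0 p
    positivity
  have mV : Measurable V := by fun_prop
  have hVint : ∫⁻ p in I ×ˢ I ×ˢ I, ENNReal.ofReal (V p) = ENNReal.ofReal (M * A - M) ∧
      0 ≤ M * A - M := by
    have h1 : ∫⁻ p in I ×ˢ I ×ˢ I, ENNReal.ofReal (P p) =
        (∫⁻ p in I ×ˢ I ×ˢ I, ENNReal.ofReal (V p)) +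
          ∫⁻ p in I ×ˢ I ×ˢ I, ENNReal.ofReal (a p ^ 6) := by
      rw [← lintegral_add_left (by fun_prop)]
      apply setLIntegral_congr_fun hcube
      intro p hp
      simp only
      rw [← ENNReal.ofReal_add (hVnonneg p hp) (pow_nonneg (ha0 p) 6)]
      congr 1
      simp only [hV]
      ring
    rw [hPint, hMa] at h1
    have h2 : ENNReal.ofReal M ≤ ENNReal.ofReal (M * A) := by rw [h1]; exact le_add_self
    have h3 : 0 ≤ M * A - M := by
      have := (ENNReal.ofReal_le_ofReal_iff (by positivity)).1 h2
      linarith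
    refine ⟨?_, h3⟩
    rw [ENNReal.ofReal_sub _ hM.le, h1, ENNReal.add_sub_cancel_right ENNReal.ofReal_ne_top]
  set G : ℝ × ℝ × ℝ → ℝ := fun p => g1 p ^ 2 + g2 p ^ 2 + g3 p ^ 2 with hG
  have mG : Measurable G := by fun_prop
  have main : ∀ l : ℝ, 0 < l → M * A ≤ l * (2 * κ / 3 * N) + 2 * κ / 3 * (M * A - M) / l := by
    intro l hl
    have hd : ∀ p ∈ I ×ˢ I ×ˢ I, 0 ≤ d1 p ∧ 0 ≤ d2 p ∧ 0 ≤ d3 p := by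
      rintro ⟨x, y, z⟩ ⟨hx, hy, hz⟩
      have b1 := tanSlope_nonneg hq2 hΘ p2 hR cF1 nF1 (hIcc hx)
      have b2 := tanSlope_nonneg hq3 hΘ p3 hR (cF2y x) (nF2 x) (hIcc hy)
      have b3 := tanSlope_nonneg hq4 hΘ p4 hR (cFz x y) (nF x y) (hIcc hz)
      have b4 := cα hx
      have b5 := cβ x hy
      have b6 := ha0 (x, y, z)
      exact ⟨by positivity, by positivity, by positivity⟩
    have chain : ENNReal.ofReal (M * A) ≤ ENNReal.ofReal
        (κ / 3 * (2 * l * N + 2 / l * (M * A - M))) := by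
      calc ENNReal.ofReal (M * A) = ∫⁻ p in I ×ˢ I ×ˢ I, ENNReal.ofReal (P p) := hPint.symm
        _ ≤ ∫⁻ p in I ×ˢ I ×ˢ I, ENNReal.ofReal (κ / 3) *
            (ENNReal.ofReal (d1 p) + ENNReal.ofReal (d2 p) + ENNReal.ofReal (d3 p)) := by
            apply setLIntegral_mono' hcube
            intro p hp
            obtain ⟨b1, b2, b3⟩ := hd p hp
            rw [← ENNReal.ofReal_add b1 b2, ← ENNReal.ofReal_add (by positivity) b3,
              ← ENNReal.ofReal_mul (by positivity)]
            exact ENNReal.ofReal_le_ofReal (ptAM p hp)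
        _ = ENNReal.ofReal (κ / 3) * ((∫⁻ p in I ×ˢ I ×ˢ I, ENNReal.ofReal (d1 p)) +
            (∫⁻ p in I ×ˢ I ×ˢ I, ENNReal.ofReal (d2 p)) +
            ∫⁻ p in I ×ˢ I ×ˢ I, ENNReal.ofReal (d3 p)) := by
            rw [lintegral_const_mul' _ _ ENNReal.ofReal_ne_top,
              lintegral_add_right _ (by fun_prop), lintegral_add_right _ (by fun_prop)]
        _ ≤ ENNReal.ofReal (κ / 3) *
            ((∫⁻ p in I ×ˢ I ×ˢ I, ENNReal.ofReal (|u1 p| * |t1 p|)) +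
            (∫⁻ p in I ×ˢ I ×ˢ I, ENNReal.ofReal (|u2 p| * |t2 p|)) +
            ∫⁻ p in I ×ˢ I ×ˢ I, ENNReal.ofReal (|u3 p| * |t3 p|)) := by
            gcongr
        _ = ENNReal.ofReal (κ / 3) * ∫⁻ p in I ×ˢ I ×ˢ I,
            (ENNReal.ofReal (|u1 p| * |t1 p|) + ENNReal.ofReal (|u2 p| * |t2 p|) +
              ENNReal.ofReal (|u3 p| * |t3 p|)) := by
            rw [lintegral_add_right _ (by fun_prop), lintegral_add_right _ (by fun_prop)]
        _ ≤ ENNReal.ofReal (κ / 3) * ∫⁻ p in I ×ˢ I ×ˢ I,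
            (ENNReal.ofReal (2 * l) * ENNReal.ofReal (G p) +
              ENNReal.ofReal (2 / l) * ENNReal.ofReal (V p)) := by
            refine mul_le_mul_right ?_ _
            apply setLIntegral_mono' hcube
            intro p hp
            rw [← ENNReal.ofReal_add (by positivity) (by positivity),
              ← ENNReal.ofReal_add (by positivity) (by positivity),
              ← ENNReal.ofReal_mul (by positivity), ← ENNReal.ofReal_mul (by positivity),
              ← ENNReal.ofReal_add (by positivity)
                (mul_nonneg (by positivity) (hVnonneg p hp)), hV' p hp]
            exact ENNReal.ofReal_le_ofReal (young_sum hl (hb1 p) (hb2 p) (hb3 p))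
        _ = ENNReal.ofReal (κ / 3) * (ENNReal.ofReal (2 * l) *
              (∫⁻ p in I ×ˢ I ×ˢ I, ENNReal.ofReal (G p)) +
              ENNReal.ofReal (2 / l) * ENNReal.ofReal (M * A - M)) := by
            rw [lintegral_add_right _ (by fun_prop),
              lintegral_const_mul' _ _ ENNReal.ofReal_ne_top,
              lintegral_const_mul' _ _ ENNReal.ofReal_ne_top, hVint.1]
        _ ≤ ENNReal.ofReal (κ / 3) * (ENNReal.ofReal (2 * l) * ENNReal.ofReal N +
              ENNReal.ofReal (2 / l) * ENNReal.ofReal (M * A - M)) := by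
            gcongr
        _ = _ := by
            rw [← ENNReal.ofReal_mul (by positivity), ← ENNReal.ofReal_mul (by positivity),
              ← ENNReal.ofReal_add (by positivity)
                (mul_nonneg (by positivity) hVint.2), ← ENNReal.ofReal_mul (by positivity)]
    have hfin := (ENNReal.ofReal_le_ofReal_iff (by
      have := hVint.2
      positivity)).1 chain
    refine hfin.trans (le_of_eq ?_)
    field_simp
  have hsq := sq_le_of_forall_pos (by positivity) (mul_nonneg (by positivity) hVint.2)
    (by positivity) main
  have hsq' : M * A ^ 2 ≤ 16 / 9 * κ ^ 2 * N * (A - 1) := by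
    refine le_of_mul_le_mul_left ?_ hM
    linarith
  have hcubed := pow_le_pow_left₀ (by positivity) hsq' 3
  have hκ6 : (κ ^ 2) ^ 3 = (M / c) ^ 2 := by rw [← hκ3]; ring
  rw [← hcA]
  have e : (16 / 9 * κ ^ 2 * N * (A - 1)) ^ 3 =
      M ^ 2 * ((16 / 9) ^ 3 * N ^ 3 * (A - 1) ^ 3 / c ^ 2) := by
    rw [mul_pow, mul_pow, mul_pow, hκ6]
    field_simp
  rw [e, show (M * A ^ 2) ^ 3 = M ^ 2 * (M * A ^ 6) by ring] at hcubed
  have hfin := le_of_mul_le_mul_left hcubed (by positivity)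
  rw [le_div_iff₀ (by positivity)] at hfin
  calc M * (c * A) ^ 6 * c ^ 2 = c ^ 6 * (M * A ^ 6 * c ^ 2) := by ring
    _ ≤ c ^ 6 * ((16 / 9) ^ 3 * N ^ 3 * (A - 1) ^ 3) := by gcongr
    _ = _ := by ring

lemma sobolev_cube_sharp {a g1 g2 g3 u1 u2 u3 : ℝ × ℝ × ℝ → ℝ} {R M N : ℝ} (hR : 0 < R)
    (ha : Continuous a) (ha0 : ∀ p, 0 ≤ a p)
    (hsupp : ∀ x y z, (R ≤ |x| ∨ R ≤ |y| ∨ R ≤ |z|) → a (x, y, z) = 0)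
    (hu1 : ∀ x y z, HasDerivAt (fun t => a (t, y, z) ^ 4) (u1 (x, y, z)) x)
    (hu2 : ∀ x y z, HasDerivAt (fun t => a (x, t, z) ^ 4) (u2 (x, y, z)) y)
    (hu3 : ∀ x y z, HasDerivAt (fun t => a (x, y, t) ^ 4) (u3 (x, y, z)) z)
    (hc1 : Continuous u1) (hc2 : Continuous u2) (hc3 : Continuous u3)
    (hg1 : Continuous g1) (hg2 : Continuous g2) (hg3 : Continuous g3)
    (hb1 : ∀ p, |u1 p| ≤ 4 * a p ^ 3 * g1 p) (hb2 : ∀ p, |u2 p| ≤ 4 * a p ^ 3 * g2 p)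
    (hb3 : ∀ p, |u3 p| ≤ 4 * a p ^ 3 * g3 p) (hM : 0 < M) (hN : 0 ≤ N)
    (hMa : ∫⁻ p in Set.Ioc (-R) R ×ˢ Set.Ioc (-R) R ×ˢ Set.Ioc (-R) R,
      ENNReal.ofReal (a p ^ 6) = ENNReal.ofReal M)
    (hNg : ∫⁻ p in Set.Ioc (-R) R ×ˢ Set.Ioc (-R) R ×ˢ Set.Ioc (-R) R,
      ENNReal.ofReal (g1 p ^ 2 + g2 p ^ 2 + g3 p ^ 2) ≤ ENNReal.ofReal N) :
    27 * Real.pi ^ 4 * M ≤ 16 * N ^ 3 := by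
  have hc : ∀ k, Continuous (cosMass k) := by
    intro k
    have h := intervalIntegral.continuous_primitive (f := fun t => Real.cos t ^ k)
      (μ := volume) (fun a b => Continuous.intervalIntegrable (by fun_prop) a b) 0
    have e : cosMass k = fun Θ => (∫ t in (0 : ℝ)..Θ, Real.cos t ^ k) -
        ∫ t in (0 : ℝ)..(-Θ), Real.cos t ^ k := by
      ext Θ
      rw [intervalIntegral.integral_interval_sub_left] <;> try rfl
      all_goals exact Continuous.intervalIntegrable (by fun_prop) _ _
    rw [e]
    exact h.sub (h.comp continuous_neg)
  have hev : ∀ᶠ Θ in nhdsWithin (Real.pi / 2) (Set.Iio (Real.pi / 2)),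
      0 < Θ ∧ Θ < Real.pi / 2 := by
    have := Ioo_mem_nhdsLT (a := 0) (b := Real.pi / 2) (by positivity)
    filter_upwards [this] with Θ h using h
  have hc0 := hc 0
  have hc1 := hc 1
  have hc2 := hc 2
  have hc3 := hc 3
  have hc4 := hc 4
  have v0 : cosMass 0 (Real.pi / 2) = Real.pi := by simp [cosMass]
  have v1 : cosMass 1 (Real.pi / 2) = 2 := by simp [cosMass]; norm_num
  have v2 : cosMass 2 (Real.pi / 2) = Real.pi / 2 := by
    rw [cosMass, integral_cos_sq]; simp
  have v3 : cosMass 3 (Real.pi / 2) = 4 / 3 := by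
    simp [cosMass]; norm_num
  have v4 : cosMass 4 (Real.pi / 2) = 3 * Real.pi / 8 := by
    have h := integral_cos_pow (a := -(Real.pi / 2)) (b := Real.pi / 2) 2
    simp at h
    rw [cosMass, h]; norm_num; ring
  have key := le_of_tendsto_of_tendsto
    (f := fun Θ => M * (cosMass 0 Θ * cosMass 1 Θ * cosMass 2 Θ) ^ 6 *
      (cosMass 2 Θ * cosMass 3 Θ * cosMass 4 Θ) ^ 2)
    (g := fun Θ => (16 / 9) ^ 3 * N ^ 3 * (cosMass 0 Θ * cosMass 1 Θ * cosMass 2 Θ -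
        cosMass 2 Θ * cosMass 3 Θ * cosMass 4 Θ) ^ 3 *
          (cosMass 2 Θ * cosMass 3 Θ * cosMass 4 Θ) ^ 3)
    (b := nhdsWithin (Real.pi / 2) (Set.Iio (Real.pi / 2)))
    ((Continuous.continuousAt (by fun_prop)).tendsto.mono_left nhdsWithin_le_nhds)
    ((Continuous.continuousAt (by fun_prop)).tendsto.mono_left nhdsWithin_le_nhds)
    (hev.mono fun Θ h => sobolev_cube_bound hR h.1 h.2 ha ha0 hsupp hu1 hu2 hu3 ‹_› ‹_› ‹_›
      hg1 hg2 hg3 hb1 hb2 hb3 hM hN hMa hNg)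
  rw [v0, v1, v2, v3, v4] at key
  have hpi := Real.pi_pos
  refine le_of_mul_le_mul_left (a := Real.pi ^ 12 / 432) ?_ (by positivity)
  linarith

/-- Cartesian coordinates on `E3`. -/
def ofCoord (p : ℝ × ℝ × ℝ) : E3 := !₂[p.1, p.2.1, p.2.2]

lemma continuous_ofCoord : Continuous ofCoord := by
  unfold ofCoord
  refine (PiLp.continuous_toLp 2 _).comp (continuous_pi fun i => ?_)
  fin_cases i <;> simp <;> fun_prop

lemma measurePreserving_ofCoord : MeasurePreserving ofCoord := by
  have h1 := (volume_preserving_finTwoArrow ℝ).symm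
  have h2 := (volume_preserving_piFinSuccAbove (fun _ : Fin 3 => ℝ) 0).symm
  have h3 := (EuclideanSpace.volume_preserving_symm_measurableEquiv_toLp (Fin 3)).symm
  have h := h3.comp (h2.comp ((MeasurePreserving.id (volume : Measure ℝ)).prod h1))
  convert h using 1
  · ext p i
    fin_cases i <;> rfl
  · rfl

lemma ofCoord_eq (x y z : ℝ) : ofCoord (x, y, z) = x • e3 0 + (y • e3 1 + z • e3 2) := by
  ext i
  fin_cases i <;> simp [ofCoord, e3]

lemma hasDerivAt_ofCoord (x y z : ℝ) :
    HasDerivAt (fun t => ofCoord (t, y, z)) (e3 0) x ∧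
    HasDerivAt (fun t => ofCoord (x, t, z)) (e3 1) y ∧
    HasDerivAt (fun t => ofCoord (x, y, t)) (e3 2) z := by
  simp only [ofCoord_eq]
  refine ⟨?_, ?_, ?_⟩
  · simpa using ((hasDerivAt_id x).smul_const (e3 0)).add_const (y • e3 1 + z • e3 2)
  · simpa using (((hasDerivAt_id y).smul_const (e3 1)).add_const (z • e3 2)).const_add (x • e3 0)
  · simpa using (((hasDerivAt_id z).smul_const (e3 2)).const_add (y • e3 1)).const_add (x • e3 0)

lemma hasDerivAt_norm_pow_four {F : ℝ → ℂ} {F' : ℂ} {x : ℝ} (h : HasDerivAt F F' x) :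
    HasDerivAt (fun t => ‖F t‖ ^ 4) (4 * ‖F x‖ ^ 2 * inner ℝ (F x) F') x := by
  have h2 := h.norm_sq.fun_pow 2
  have e : (fun t => (‖F t‖ ^ 2) ^ 2) = fun t => ‖F t‖ ^ 4 := by
    ext t
    ring
  rw [e] at h2
  refine h2.congr_deriv ?_
  push_cast
  ring

lemma abs_inner_bound (w v : ℂ) :
    |4 * ‖w‖ ^ 2 * inner ℝ w v| ≤ 4 * ‖w‖ ^ 3 * ‖v‖ := by
  rw [abs_mul, abs_of_nonneg (by positivity : (0 : ℝ) ≤ 4 * ‖w‖ ^ 2)]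
  calc 4 * ‖w‖ ^ 2 * |inner ℝ w v| ≤ 4 * ‖w‖ ^ 2 * (‖w‖ * ‖v‖) := by
        gcongr
        exact abs_real_inner_le_norm w v
    _ = _ := by ring

lemma continuous_pdC {f : E3 → ℂ} (hf : ContDiff ℝ 1 f) (i : Fin 3) : Continuous (pdC i f) :=
  (hf.continuous_fderiv one_ne_zero).clm_apply continuous_const

lemma continuous_gradSqC {f : E3 → ℂ} (hf : ContDiff ℝ 1 f) : Continuous (gradSqC f) :=
  continuous_finsetSum _ fun i _ => (continuous_pdC hf i).norm.pow 2

lemma gradSqC_nonneg (f : E3 → ℂ) (x : E3) : 0 ≤ gradSqC f x :=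
  Finset.sum_nonneg fun _ _ => sq_nonneg _

/-- The sharp Sobolev inequality for compactly supported functions. -/
lemma sobolev_sharp_of_hasCompactSupport {f : E3 → ℂ} (hf : ContDiff ℝ 1 f)
    (hs : HasCompactSupport f) :
    27 * Real.pi ^ 4 * ∫ x, ‖f x‖ ^ 6 ≤ 16 * (∫ x, gradSqC f x) ^ 3 := by
  have hN : 0 ≤ ∫ x, gradSqC f x := integral_nonneg (gradSqC_nonneg f)
  have hM : 0 ≤ ∫ x, ‖f x‖ ^ 6 := integral_nonneg fun x => by positivity
  rcases hM.eq_or_lt with hM | hM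
  · rw [← hM]
    simpa using by positivity
  have hfc := hf.continuous
  have hO := continuous_ofCoord
  have i6 : Integrable (fun x => ‖f x‖ ^ 6) :=
    (hfc.norm.pow 6).integrable_of_hasCompactSupport
      (hs.mono fun x hx hx0 => hx (by simp [hx0]))
  have ig : Integrable (gradSqC f) := by
    refine (continuous_gradSqC hf).integrable_of_hasCompactSupport ?_
    exact (hs.fderiv (𝕜 := ℝ)).mono fun x hx hx0 => hx (by simp [gradSqC, pdC, hx0])
  obtain ⟨R, hR, hsub⟩ := hs.isCompact.isBounded.subset_ball_lt 0 0
  have hz : ∀ x y z, (R ≤ |x| ∨ R ≤ |y| ∨ R ≤ |z|) → f (ofCoord (x, y, z)) = 0 := by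
    intro x y z h
    by_contra hne
    have := hsub (subset_tsupport f hne)
    rw [mem_ball_zero_iff] at this
    have hi : ∀ i, |ofCoord (x, y, z) i| < R := fun i =>
      lt_of_le_of_lt (by simpa using PiLp.norm_apply_le (ofCoord (x, y, z)) i) this
    have h0 := hi 0
    have h1 := hi 1
    have h2 := hi 2
    rw [show ofCoord (x, y, z) 0 = x from rfl] at h0
    rw [show ofCoord (x, y, z) 1 = y from rfl] at h1
    rw [show ofCoord (x, y, z) 2 = z from rfl] at h2
    rcases h with h | h | h <;> linarith
  have hd : ∀ x, HasFDerivAt f (fderiv ℝ f x) x := fun x =>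
    (hf.differentiable one_ne_zero x).hasFDerivAt
  obtain ⟨a, ha⟩ : ∃ a : ℝ × ℝ × ℝ → ℝ, ∀ p, a p = ‖f (ofCoord p)‖ := ⟨_, fun _ => rfl⟩
  obtain ⟨g, hg⟩ : ∃ g : Fin 3 → ℝ × ℝ × ℝ → ℝ, ∀ i p, g i p = ‖pdC i f (ofCoord p)‖ :=
    ⟨_, fun _ _ => rfl⟩
  obtain ⟨u, hu⟩ : ∃ u : Fin 3 → ℝ × ℝ × ℝ → ℝ, ∀ i p, u i p =
      4 * ‖f (ofCoord p)‖ ^ 2 * inner ℝ (f (ofCoord p)) (pdC i f (ofCoord p)) :=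
    ⟨_, fun _ _ => rfl⟩
  have hac : Continuous a := by
    rw [funext ha]
    exact (hfc.comp hO).norm
  have hgc : ∀ i, Continuous (g i) := fun i => by
    rw [funext (hg i)]
    exact ((continuous_pdC hf i).comp hO).norm
  have huc : ∀ i, Continuous (u i) := fun i => by
    rw [funext (hu i)]
    exact (continuous_const.mul ((hfc.comp hO).norm.pow 2)).mul
      ((hfc.comp hO).inner ((continuous_pdC hf i).comp hO))
  have hb : ∀ i p, |u i p| ≤ 4 * a p ^ 3 * g i p := fun i p => by
    rw [hu, ha, hg]
    exact abs_inner_bound _ _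
  have h4 : ∀ (γ : ℝ → ℝ × ℝ × ℝ) (i : Fin 3) (t : ℝ),
      HasDerivAt (fun s => ofCoord (γ s)) (e3 i) t →
      HasDerivAt (fun s => a (γ s) ^ 4) (u i (γ t)) t := fun γ i t h => by
    simp only [ha, hu]
    exact hasDerivAt_norm_pow_four ((hd _).comp_hasDerivAt t h)
  have haz : ∀ x y z, (R ≤ |x| ∨ R ≤ |y| ∨ R ≤ |z|) → a (x, y, z) = 0 := fun x y z h => by
    rw [ha, hz x y z h, norm_zero]
  refine sobolev_cube_sharp hR hac (fun p => by rw [ha]; exact norm_nonneg _) haz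
    (fun x y z => h4 (fun t => (t, y, z)) 0 x (hasDerivAt_ofCoord x y z).1)
    (fun x y z => h4 (fun t => (x, t, z)) 1 y (hasDerivAt_ofCoord x y z).2.1)
    (fun x y z => h4 (fun t => (x, y, t)) 2 z (hasDerivAt_ofCoord x y z).2.2)
    (huc 0) (huc 1) (huc 2) (hgc 0) (hgc 1) (hgc 2) (hb 0) (hb 1) (hb 2) hM hN ?_ ?_
  · have hm : Measurable fun x => ENNReal.ofReal (‖f x‖ ^ 6) :=
      (hfc.norm.pow 6).measurable.ennreal_ofReal
    rw [ofReal_integral_eq_lintegral_ofReal i6 (ae_of_all _ fun x => by positivity),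
      ← measurePreserving_ofCoord.lintegral_comp hm]
    simp only [← ha]
    refine setLIntegral_eq_of_support_subset ?_
    rintro ⟨x, y, z⟩ h
    by_contra hn
    refine h ?_
    have : a (x, y, z) = 0 := by
      refine haz x y z ?_
      by_contra! h'
      simp only [abs_lt] at h'
      exact hn ⟨⟨h'.1.1, h'.1.2.le⟩, ⟨h'.2.1.1, h'.2.1.2.le⟩, ⟨h'.2.2.1, h'.2.2.2.le⟩⟩
    simp [this]
  · rw [ofReal_integral_eq_lintegral_ofReal ig (ae_of_all _ (gradSqC_nonneg f)),
      ← measurePreserving_ofCoord.lintegral_comp (continuous_gradSqC hf).measurable.ennreal_ofReal]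
    refine (setLIntegral_le_lintegral _ _).trans (le_of_eq ?_)
    simp only [gradSqC, Fin.sum_univ_three, hg]

/-- Smooth cutoffs at scale `r` whose gradients have a scale-independent `L³` norm. -/
lemma exists_cutoff : ∃ C : ℝ, ∀ r : ℝ, 0 < r → ∃ η : E3 → ℝ, ContDiff ℝ 1 η ∧
    HasCompactSupport η ∧ (∀ x, 0 ≤ η x) ∧ (∀ x, η x ≤ 1) ∧ (∀ x, ‖x‖ < r → η x = 1) ∧
    (∀ x, ‖x‖ < r → fderiv ℝ η x = 0) ∧ ∫ x, ‖fderiv ℝ η x‖ ^ 3 = C := by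
  let χ : ContDiffBump (0 : E3) := ⟨1, 2, one_pos, one_lt_two⟩
  refine ⟨∫ x, ‖fderiv ℝ χ x‖ ^ 3, fun r hr => ⟨fun x => χ (r⁻¹ • x), ?_, ?_, fun x => χ.nonneg,
    fun x => χ.le_one, ?_, ?_, ?_⟩⟩
  · exact χ.contDiff.comp (contDiff_const_smul _)
  · exact χ.hasCompactSupport.comp_smul (inv_ne_zero hr.ne')
  · intro x hx
    refine χ.one_of_mem_closedBall ?_
    rw [mem_closedBall_zero_iff, norm_smul, norm_inv, Real.norm_of_nonneg hr.le]
    exact (inv_mul_le_one₀ hr).2 hx.le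
  · intro x hx
    have hm : r⁻¹ • x ∈ Metric.ball (0 : E3) χ.rIn := by
      rw [mem_ball_zero_iff, norm_smul, norm_inv, Real.norm_of_nonneg hr.le]
      exact (inv_mul_lt_one₀ hr).2 hx
    rw [fderiv_comp_smul, (χ.eventuallyEq_one_of_mem_ball hm).fderiv_eq]
    simp
  · simp only [fderiv_comp_smul, norm_smul, mul_pow]
    rw [integral_const_mul, Measure.integral_comp_inv_smul volume
      (fun x => ‖fderiv ℝ χ x‖ ^ 3) r]
    simp only [finrank_euclideanSpace_fin, smul_eq_mul, norm_inv, Real.norm_of_nonneg hr.le]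
    rw [abs_of_pos (by positivity), ← mul_assoc, inv_pow, inv_mul_cancel₀ (by positivity), one_mul]

lemma norm_add_sq_le {δ : ℝ} (hδ : 0 < δ) (z w : ℂ) :
    ‖z + w‖ ^ 2 ≤ (1 + δ) * ‖z‖ ^ 2 + (1 + 1 / δ) * ‖w‖ ^ 2 := by
  have h1 : ‖z + w‖ ^ 2 ≤ (‖z‖ + ‖w‖) ^ 2 := by
    gcongr
    exact norm_add_le z w
  have h2 : 0 ≤ (δ * ‖z‖ - ‖w‖) ^ 2 / δ := by positivity
  have h3 : (δ * ‖z‖ - ‖w‖) ^ 2 / δ = δ * ‖z‖ ^ 2 - 2 * ‖z‖ * ‖w‖ + 1 / δ * ‖w‖ ^ 2 := by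
    field_simp
    ring
  nlinarith

lemma sq_mul_sq_le {a b l : ℝ} (hb : 0 ≤ b) (hl : 0 < l) :
    a ^ 2 * b ^ 2 ≤ l ^ 2 * a ^ 6 + b ^ 3 / l := by
  rcases le_total (l * a ^ 2) b with h | h
  · have : a ^ 2 * b ^ 2 ≤ b ^ 3 / l := by
      rw [le_div_iff₀ hl]
      nlinarith [mul_le_mul_of_nonneg_right h (sq_nonneg b)]
    have : 0 ≤ l ^ 2 * a ^ 6 := by positivity
    linarith
  · have : b ^ 2 ≤ (l * a ^ 2) ^ 2 := by gcongr
    have h2 : 0 ≤ b ^ 3 / l := by positivity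
    nlinarith [mul_le_mul_of_nonneg_left this (sq_nonneg a)]

lemma gradSqC_smul_le {f : E3 → ℂ} {η : E3 → ℝ} {x : E3} (hf : DifferentiableAt ℝ f x)
    (hη : DifferentiableAt ℝ η x) (h0 : 0 ≤ η x) (h1 : η x ≤ 1) {δ : ℝ} (hδ : 0 < δ) :
    gradSqC (fun y => η y • f y) x ≤
      (1 + δ) * gradSqC f x + 3 * (1 + 1 / δ) * (‖f x‖ ^ 2 * ‖fderiv ℝ η x‖ ^ 2) := by
  have key : ∀ i, ‖pdC i (fun y => η y • f y) x‖ ^ 2 ≤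
      (1 + δ) * ‖pdC i f x‖ ^ 2 + (1 + 1 / δ) * (‖f x‖ ^ 2 * ‖fderiv ℝ η x‖ ^ 2) := by
    intro i
    rw [pdC, fderiv_fun_smul hη hf]
    refine (norm_add_sq_le hδ _ _).trans ?_
    have hA : ‖(η x • fderiv ℝ f x) (e3 i)‖ ≤ ‖pdC i f x‖ := by
      rw [smul_apply, norm_smul, Real.norm_of_nonneg h0]
      exact mul_le_of_le_one_left (norm_nonneg _) h1
    have hB : ‖((fderiv ℝ η x).smulRight (f x)) (e3 i)‖ ≤ ‖f x‖ * ‖fderiv ℝ η x‖ := by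
      rw [ContinuousLinearMap.smulRight_apply, norm_smul, mul_comm]
      gcongr
      simpa [e3] using (fderiv ℝ η x).le_opNorm (e3 i)
    rw [← mul_pow]
    gcongr
    · exact hA
    · exact hB
  calc _ ≤ ∑ i : Fin 3, ((1 + δ) * ‖pdC i f x‖ ^ 2 +
        (1 + 1 / δ) * (‖f x‖ ^ 2 * ‖fderiv ℝ η x‖ ^ 2)) := Finset.sum_le_sum fun i _ => key i
    _ = _ := by
      rw [Finset.sum_add_distrib, ← Finset.mul_sum, gradSqC]
      simp
      ring

lemma tendsto_setIntegral_norm_ge {F : E3 → ℝ} (hF : Integrable F) :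
    Filter.Tendsto (fun n : ℕ => ∫ x, {x : E3 | (n : ℝ) + 1 ≤ ‖x‖}.indicator F x)
      Filter.atTop (nhds 0) := by
  have h := tendsto_integral_of_dominated_convergence (μ := volume)
    (F := fun (n : ℕ) x => {x : E3 | (n : ℝ) + 1 ≤ ‖x‖}.indicator F x) (f := fun _ : E3 => (0 : ℝ))
    (fun x => ‖F x‖) (fun n => hF.aestronglyMeasurable.indicator
      (measurableSet_le measurable_const measurable_norm)) hF.norm
    (fun n => ae_of_all _ fun x => norm_indicator_le_norm_self F x)
    (ae_of_all _ fun x => ?_)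
  · simpa using h
  · obtain ⟨m, hm⟩ := exists_nat_gt ‖x‖
    refine tendsto_const_nhds.congr' ?_
    filter_upwards [Filter.eventually_ge_atTop m] with n hn
    rw [Set.indicator_of_notMem]
    have : (m : ℝ) ≤ n := by exact_mod_cast hn
    simp only [Set.mem_ofPred_eq, not_le]
    linarith

/-- The sharp Sobolev inequality. -/
lemma sobolev_sharp {f : E3 → ℂ} (hf : ContDiff ℝ 1 f)
    (hf6 : Integrable (fun x : E3 => ‖f x‖ ^ 6)) (hgrad : Integrable (gradSqC f)) :
    27 * Real.pi ^ 4 * ∫ x, ‖f x‖ ^ 6 ≤ 16 * (∫ x, gradSqC f x) ^ 3 := by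
  obtain ⟨C, hC⟩ := exists_cutoff
  choose η hη hs h0 h1 hone hzero hint using fun n : ℕ => hC (n + 1) n.cast_add_one_pos
  have hsm : ∀ n, ContDiff ℝ 1 (fun x => η n x • f x) := fun n => (hη n).smul hf
  have hcs : ∀ n, HasCompactSupport (fun x => η n x • f x) := fun n => (hs n).smul_right
  have hi3 : ∀ n, Integrable fun x => ‖fderiv ℝ (η n) x‖ ^ 3 := fun n =>
    (((hη n).continuous_fderiv one_ne_zero).norm.pow 3).integrable_of_hasCompactSupport
      (((hs n).fderiv (𝕜 := ℝ)).mono fun x hx hx0 => hx (by simp [hx0]))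
  have hlim : Filter.Tendsto (fun n => ∫ x, ‖η n x • f x‖ ^ 6) Filter.atTop
      (nhds (∫ x, ‖f x‖ ^ 6)) := by
    refine tendsto_integral_of_dominated_convergence (fun x => ‖f x‖ ^ 6)
      (fun n => ((hsm n).continuous.norm.pow 6).aestronglyMeasurable) hf6
      (fun n => ae_of_all _ fun x => ?_) (ae_of_all _ fun x => ?_)
    · rw [Real.norm_of_nonneg (by positivity), norm_smul, Real.norm_of_nonneg (h0 n x)]
      exact pow_le_pow_left₀ (mul_nonneg (h0 n x) (norm_nonneg _))
        (mul_le_of_le_one_left (norm_nonneg (f x)) (h1 n x)) 6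
    · obtain ⟨m, hm⟩ := exists_nat_gt ‖x‖
      refine tendsto_const_nhds.congr' ?_
      filter_upwards [Filter.eventually_ge_atTop m] with n hn
      have : (m : ℝ) ≤ n := by exact_mod_cast hn
      rw [hone n x (by linarith), one_smul]
  have hbound : ∀ δ l : ℝ, 0 < δ → 0 < l → ∀ n : ℕ, ∫ x, gradSqC (fun y => η n y • f y) x ≤
      (1 + δ) * (∫ x, gradSqC f x) + 3 * (1 + 1 / δ) * (l ^ 2 *
        (∫ x, {x : E3 | (n : ℝ) + 1 ≤ ‖x‖}.indicator (fun x => ‖f x‖ ^ 6) x) + C / l) := by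
    intro δ l hδ hl n
    have ht : Integrable ({x : E3 | (n : ℝ) + 1 ≤ ‖x‖}.indicator (fun x => ‖f x‖ ^ 6)) :=
      hf6.indicator (measurableSet_le measurable_const measurable_norm)
    have hr : Integrable fun x => l ^ 2 *
        {x : E3 | (n : ℝ) + 1 ≤ ‖x‖}.indicator (fun x => ‖f x‖ ^ 6) x +
        ‖fderiv ℝ (η n) x‖ ^ 3 / l := (ht.const_mul _).add ((hi3 n).div_const _)
    rw [← hint n, ← integral_const_mul, ← integral_const_mul, ← integral_div, ← integral_add
      (ht.const_mul _) ((hi3 n).div_const _), ← integral_const_mul,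
      ← integral_add (hgrad.const_mul _) (hr.const_mul _)]
    refine integral_mono_of_nonneg (ae_of_all _ (gradSqC_nonneg _))
      ((hgrad.const_mul _).add (hr.const_mul _)) (ae_of_all _ fun x => ?_)
    refine (gradSqC_smul_le (hf.differentiable one_ne_zero x)
      ((hη n).differentiable one_ne_zero x) (h0 n x) (h1 n x) hδ).trans ?_
    dsimp only
    gcongr
    by_cases hx : ‖x‖ < n + 1
    · rw [hzero n x hx, Set.indicator_of_notMem (by simpa using hx)]
      simp
    · rw [Set.indicator_of_mem (by simpa using hx)]
      exact sq_mul_sq_le (norm_nonneg _) hl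
  have hb2 : ∀ δ l : ℝ, 0 < δ → 0 < l → 27 * Real.pi ^ 4 * ∫ x, ‖f x‖ ^ 6 ≤
      16 * ((1 + δ) * (∫ x, gradSqC f x) + 3 * (1 + 1 / δ) * (C / l)) ^ 3 := by
    intro δ l hδ hl
    have ht := tendsto_setIntegral_norm_ge hf6
    refine le_of_tendsto_of_tendsto' (hlim.const_mul _) (b := Filter.atTop)
      (g := fun n : ℕ => 16 * ((1 + δ) * (∫ x, gradSqC f x) + 3 * (1 + 1 / δ) * (l ^ 2 *
        (∫ x, {x : E3 | (n : ℝ) + 1 ≤ ‖x‖}.indicator (fun x => ‖f x‖ ^ 6) x) + C / l)) ^ 3) ?_ ?_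
    · have := (((((ht.const_mul (l ^ 2)).add_const (C / l)).const_mul
        (3 * (1 + 1 / δ))).const_add ((1 + δ) * (∫ x, gradSqC f x))).pow 3).const_mul 16
      simpa using this
    · intro n
      refine (sobolev_sharp_of_hasCompactSupport (hsm n) (hcs n)).trans ?_
      have : 0 ≤ ∫ x, gradSqC (fun y => η n y • f y) x :=
        integral_nonneg (gradSqC_nonneg _)
      gcongr
      exact hbound δ l hδ hl n
  have hb3 : ∀ δ : ℝ, 0 < δ → 27 * Real.pi ^ 4 * ∫ x, ‖f x‖ ^ 6 ≤
      16 * ((1 + δ) * (∫ x, gradSqC f x)) ^ 3 := by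
    intro δ hδ
    have h := ((((tendsto_const_nhds (x := C)).div_atTop Filter.tendsto_id).const_mul
      (3 * (1 + 1 / δ))).const_add ((1 + δ) * (∫ x, gradSqC f x))).pow 3 |>.const_mul 16
    rw [mul_zero, add_zero] at h
    refine ge_of_tendsto h ?_
    filter_upwards [Filter.eventually_gt_atTop 0] with l hl using hb2 δ l hδ hl
  have h : Filter.Tendsto (fun δ : ℝ => 16 * ((1 + δ) * (∫ x, gradSqC f x)) ^ 3)
      (nhdsWithin 0 (Set.Ioi 0)) (nhds (16 * ((1 + 0) * (∫ x, gradSqC f x)) ^ 3)) :=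
    (Continuous.continuousAt (by fun_prop)).tendsto.mono_left nhdsWithin_le_nhds
  rw [add_zero, one_mul] at h
  refine ge_of_tendsto h ?_
  filter_upwards [self_mem_nhdsWithin] with δ hδ using hb3 δ hδ

lemma integral_Ioi_comp_div_sqrt_three {P p : ℝ → ℝ} {l : ℝ} (hd : ∀ t, HasDerivAt P (p t) t)
    (hp : ∀ t, 0 ≤ p t) (h0 : P 0 = 0) (hl : Filter.Tendsto P Filter.atTop (nhds l)) :
    IntegrableOn (fun r => p (r / √3)) (Set.Ioi 0) ∧
      ∫ r in Set.Ioi (0 : ℝ), p (r / √3) = √3 * l := by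
  have h3 : (0 : ℝ) < √3 := by positivity
  have hd' : ∀ r ∈ Set.Ici (0 : ℝ), HasDerivAt (fun r => √3 * P (r / √3)) (p (r / √3)) r := by
    intro r _
    have := ((hd (r / √3)).comp r ((hasDerivAt_id r).div_const (√3))).const_mul (√3)
    refine this.congr_deriv ?_
    field_simp
  have hl' : Filter.Tendsto (fun r => √3 * P (r / √3)) Filter.atTop (nhds (√3 * l)) :=
    (hl.comp (Filter.tendsto_id.atTop_div_const h3)).const_mul _
  refine ⟨integrableOn_Ioi_deriv_of_nonneg' hd' (fun r _ => hp _) hl', ?_⟩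
  rw [integral_Ioi_of_hasDerivAt_of_nonneg' hd' (fun r _ => hp _) hl']
  simp [h0]

lemma tendsto_arctan_add {q : ℝ → ℝ} {c : ℝ} (hq : ∀ t, 0 < t → |q t| ≤ 1 / t) :
    Filter.Tendsto (fun t => c * Real.arctan t + q t) Filter.atTop (nhds (c * (Real.pi / 2))) := by
  have h1 : Filter.Tendsto Real.arctan Filter.atTop (nhds (Real.pi / 2)) :=
    Real.tendsto_arctan_atTop.mono_right nhdsWithin_le_nhds
  have h2 : Filter.Tendsto q Filter.atTop (nhds 0) := by
    refine squeeze_zero_norm' (a := fun t => 1 / t) ?_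
      (by simpa using tendsto_inv_atTop_zero (𝕜 := ℝ))
    filter_upwards [Filter.eventually_gt_atTop 0] with t ht using hq t ht
  simpa using (h1.const_mul c).add h2

lemma integral_radial_grad : IntegrableOn (fun r => (r / √3) ^ 4 / (1 + (r / √3) ^ 2) ^ 3)
      (Set.Ioi 0) ∧ ∫ r in Set.Ioi (0 : ℝ), (r / √3) ^ 4 / (1 + (r / √3) ^ 2) ^ 3 =
      √3 * (3 / 8 * (Real.pi / 2)) := by
  refine integral_Ioi_comp_div_sqrt_three (p := fun t => t ^ 4 / (1 + t ^ 2) ^ 3)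
    (P := fun t => 3 / 8 * Real.arctan t + -(5 * t ^ 3 + 3 * t) / (8 * (1 + t ^ 2) ^ 2))
    (fun t => ?_) (fun t => by positivity) (by simp) (tendsto_arctan_add fun t ht => ?_)
  · have hn : (8 * (1 + t ^ 2) ^ 2) ≠ 0 := by positivity
    have h1 : HasDerivAt (fun t : ℝ => -(5 * t ^ 3 + 3 * t)) (-(15 * t ^ 2 + 3)) t := by
      have := (((hasDerivAt_pow 3 t).const_mul 5).add ((hasDerivAt_id t).const_mul 3)).neg
      refine this.congr_deriv ?_
      norm_num
      ring
    have h2 : HasDerivAt (fun t : ℝ => 8 * (1 + t ^ 2) ^ 2) (32 * t * (1 + t ^ 2)) t := by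
      have := ((((hasDerivAt_pow 2 t).const_add 1).fun_pow 2).const_mul 8)
      refine this.congr_deriv ?_
      norm_num
      ring
    refine (((Real.hasDerivAt_arctan t).const_mul (3 / 8)).add (h1.div h2 hn)).congr_deriv ?_
    have : 1 + t ^ 2 ≠ 0 := by positivity
    field_simp
    ring
  · rw [abs_div, abs_neg, abs_of_pos (by positivity : 0 < 5 * t ^ 3 + 3 * t),
      abs_of_pos (by positivity), div_le_div_iff₀ (by positivity) ht]
    nlinarith [pow_pos ht 2, pow_pos ht 4]

lemma integral_radial_pow : IntegrableOn (fun r => 3 * (r / √3) ^ 2 / (1 + (r / √3) ^ 2) ^ 3)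
      (Set.Ioi 0) ∧ ∫ r in Set.Ioi (0 : ℝ), 3 * (r / √3) ^ 2 / (1 + (r / √3) ^ 2) ^ 3 =
      √3 * (3 / 8 * (Real.pi / 2)) := by
  refine integral_Ioi_comp_div_sqrt_three (p := fun t => 3 * t ^ 2 / (1 + t ^ 2) ^ 3)
    (P := fun t => 3 / 8 * Real.arctan t + 3 * (t ^ 3 - t) / (8 * (1 + t ^ 2) ^ 2))
    (fun t => ?_) (fun t => by positivity) (by simp) (tendsto_arctan_add fun t ht => ?_)
  · have hn : (8 * (1 + t ^ 2) ^ 2) ≠ 0 := by positivity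
    have h1 : HasDerivAt (fun t : ℝ => 3 * (t ^ 3 - t)) (9 * t ^ 2 - 3) t := by
      have := ((hasDerivAt_pow 3 t).sub (hasDerivAt_id t)).const_mul 3
      refine this.congr_deriv ?_
      norm_num
      ring
    have h2 : HasDerivAt (fun t : ℝ => 8 * (1 + t ^ 2) ^ 2) (32 * t * (1 + t ^ 2)) t := by
      have := ((((hasDerivAt_pow 2 t).const_add 1).fun_pow 2).const_mul 8)
      refine this.congr_deriv ?_
      norm_num
      ring
    refine (((Real.hasDerivAt_arctan t).const_mul (3 / 8)).add (h1.div h2 hn)).congr_deriv ?_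
    have : 1 + t ^ 2 ≠ 0 := by positivity
    field_simp
    ring
  · rw [abs_div, abs_of_pos (by positivity : 0 < 8 * (1 + t ^ 2) ^ 2),
      div_le_div_iff₀ (by positivity) ht]
    have : |3 * (t ^ 3 - t)| ≤ 3 * (t ^ 3 + t) := by
      rw [abs_le]
      constructor <;> nlinarith [pow_pos ht 3]
    nlinarith [pow_pos ht 2, pow_pos ht 4]

lemma integral_norm_E3 (F : ℝ → ℝ) : ∫ x : E3, F ‖x‖ =
    4 * Real.pi * ∫ r in Set.Ioi (0 : ℝ), r ^ 2 * F r := by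
  rw [integral_fun_norm_addHaar volume F]
  simp [Measure.real, EuclideanSpace.volume_ball_fin_three]
  rw [ENNReal.toReal_ofReal (by positivity)]
  ring

lemma W_pow_six (x : E3) : W x ^ 6 = 1 / (1 + ‖x‖ ^ 2 / 3) ^ 3 := by
  have ha : (0 : ℝ) < 1 + ‖x‖ ^ 2 / 3 := by positivity
  rw [W, ← Real.rpow_natCast, ← Real.rpow_mul ha.le,
    show -(1 : ℝ) / 2 * (6 : ℕ) = -(3 : ℕ) by norm_num, Real.rpow_neg ha.le, Real.rpow_natCast,
    one_div]

lemma hasFDerivAt_W (x : E3) : HasFDerivAt W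
    ((-(1 / 3) * (1 + ‖x‖ ^ 2 / 3) ^ (-(3 : ℝ) / 2)) • innerSL ℝ x) x := by
  have ha : (0 : ℝ) < 1 + ‖x‖ ^ 2 / 3 := by positivity
  have h := (((hasStrictFDerivAt_norm_sq x).hasFDerivAt.mul_const (1 / 3)).const_add
    1).rpow_const (p := -(1 : ℝ) / 2) (Or.inl (by positivity))
  have e : (fun x : E3 => (1 + ‖x‖ ^ 2 * (1 / 3)) ^ (-(1 : ℝ) / 2)) = W := by
    ext y
    rw [W, mul_one_div]
  rw [e] at h
  refine h.congr_fderiv ?_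
  ext v
  simp
  norm_num [mul_one_div]
  ring_nf

lemma gradSqR_W (x : E3) : gradSqR W x = ‖x‖ ^ 2 / 9 / (1 + ‖x‖ ^ 2 / 3) ^ 3 := by
  have ha : (0 : ℝ) < 1 + ‖x‖ ^ 2 / 3 := by positivity
  have hp : ((1 + ‖x‖ ^ 2 / 3) ^ (-(3 : ℝ) / 2)) ^ 2 = 1 / (1 + ‖x‖ ^ 2 / 3) ^ 3 := by
    rw [← Real.rpow_natCast, ← Real.rpow_mul ha.le,
      show -(3 : ℝ) / 2 * (2 : ℕ) = -(3 : ℕ) by norm_num, Real.rpow_neg ha.le, Real.rpow_natCast,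
      one_div]
  have hpd : ∀ i, pdR i W x ^ 2 = 1 / 9 * (1 / (1 + ‖x‖ ^ 2 / 3) ^ 3) * x i ^ 2 := by
    intro i
    rw [pdR, (hasFDerivAt_W x).fderiv, ← hp]
    simp [e3, EuclideanSpace.inner_single_right]
    ring
  have hn : ‖x‖ ^ 2 = ∑ i, x i ^ 2 := by simp [EuclideanSpace.norm_sq_eq]
  rw [gradSqR, Finset.sum_congr rfl fun i _ => hpd i, ← Finset.mul_sum, ← hn]
  ring

lemma gradSqC_Wc (x : E3) : gradSqC Wc x = gradSqR W x := by
  have h : HasFDerivAt Wc (ofRealCLM ∘L fderiv ℝ W x) x :=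
    ofRealCLM.hasFDerivAt.comp x (hasFDerivAt_W x).differentiableAt.hasFDerivAt
  refine Finset.sum_congr rfl fun i _ => ?_
  rw [pdC, h.fderiv]
  simp [pdR]

lemma integral_gradSqR_W : Integrable (gradSqR W) ∧
    ∫ x, gradSqR W x = 3 * √3 * Real.pi ^ 2 / 4 := by
  have e : gradSqR W = fun x => (fun r : ℝ => r ^ 2 / 9 / (1 + r ^ 2 / 3) ^ 3) ‖x‖ :=
    funext gradSqR_W
  have e2 : ∀ r : ℝ, r ^ 2 * (r ^ 2 / 9 / (1 + r ^ 2 / 3) ^ 3) =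
      (r / √3) ^ 4 / (1 + (r / √3) ^ 2) ^ 3 := by
    intro r
    have h4 : √3 ^ 4 = 9 := by
      rw [show √3 ^ 4 = (√3 ^ 2) ^ 2 by ring, Real.sq_sqrt (by norm_num)]
      norm_num
    rw [div_pow, div_pow, h4, Real.sq_sqrt (by norm_num)]
    ring
  rw [e]
  constructor
  · refine (integrable_fun_norm_addHaar volume
      (f := fun r : ℝ => r ^ 2 / 9 / (1 + r ^ 2 / 3) ^ 3)).2 ?_
    simpa [e2] using integral_radial_grad.1
  · rw [integral_norm_E3 fun r : ℝ => r ^ 2 / 9 / (1 + r ^ 2 / 3) ^ 3]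
    simp only [e2]
    rw [integral_radial_grad.2]
    ring

lemma integral_Wc_pow_six : Integrable (fun x => ‖Wc x‖ ^ 6) ∧
    ∫ x, ‖Wc x‖ ^ 6 = 3 * √3 * Real.pi ^ 2 / 4 := by
  have e : (fun x => ‖Wc x‖ ^ 6) = fun x : E3 => (fun r : ℝ => 1 / (1 + r ^ 2 / 3) ^ 3) ‖x‖ := by
    ext x
    dsimp only
    rw [← W_pow_six, Wc, norm_real, Real.norm_eq_abs, Even.pow_abs (by decide)]
  have e2 : ∀ r : ℝ, r ^ 2 * (1 / (1 + r ^ 2 / 3) ^ 3) =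
      3 * (r / √3) ^ 2 / (1 + (r / √3) ^ 2) ^ 3 := by
    intro r
    rw [div_pow, Real.sq_sqrt (by norm_num)]
    ring
  rw [e]
  constructor
  · refine (integrable_fun_norm_addHaar volume
      (f := fun r : ℝ => 1 / (1 + r ^ 2 / 3) ^ 3)).2 ?_
    have := integral_radial_pow.1
    simp only [← e2] at this
    simpa using this
  · rw [integral_norm_E3 fun r : ℝ => 1 / (1 + r ^ 2 / 3) ^ 3]
    simp only [e2]
    rw [integral_radial_pow.2]
    ring

/-- Energy trapping below the ground state gradient norm. -/
theorem energy_trapping (f : E3 → ℂ) (hf : ContDiff ℝ 1 f)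
    (hf6 : Integrable (fun x : E3 => ‖f x‖ ^ 6))
    (hgrad : Integrable (gradSqC f))
    (hle : (∫ x : E3, gradSqC f x) ≤ ∫ x : E3, gradSqR W x) :
    (∫ x : E3, gradSqC f x) * Ecrit Wc ≤ (∫ x : E3, gradSqR W x) * Ecrit f ∧
    0 ≤ Ecrit f ∧
    (∫ x : E3, ‖f x‖ ^ 6)
      ≤ ((∫ x : E3, gradSqC f x) / ∫ x : E3, gradSqR W x) ^ 2
        * ∫ x : E3, gradSqC f x := by
  have hW : Ecrit Wc = (∫ x, gradSqR W x) / 3 := by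
    have e : gradSqC Wc = gradSqR W := funext gradSqC_Wc
    rw [Ecrit, e, integral_sub (integral_gradSqR_W.1.const_mul _)
      (integral_Wc_pow_six.1.const_mul _), integral_const_mul, integral_const_mul,
      integral_Wc_pow_six.2, integral_gradSqR_W.2]
    ring
  have hE : Ecrit f = 1 / 2 * (∫ x, gradSqC f x) - 1 / 6 * ∫ x, ‖f x‖ ^ 6 := by
    rw [Ecrit, integral_sub (hgrad.const_mul _) (hf6.const_mul _), integral_const_mul,
      integral_const_mul]
  have hS := sobolev_sharp hf hf6 hgrad
  have hN : 0 ≤ ∫ x, gradSqC f x := integral_nonneg (gradSqC_nonneg f)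
  have hG2 : 16 * (∫ x, gradSqR W x) ^ 2 = 27 * Real.pi ^ 4 := by
    rw [integral_gradSqR_W.2]
    have : √3 ^ 2 = 3 := Real.sq_sqrt (by norm_num)
    linear_combination 9 * Real.pi ^ 4 * this
  have hG : 0 < ∫ x, gradSqR W x := by
    rw [integral_gradSqR_W.2]
    positivity
  rw [hW, hE]
  generalize (∫ x, gradSqR W x) = G at *
  generalize (∫ x, gradSqC f x) = N at *
  generalize (∫ x, ‖f x‖ ^ 6) = M at *
  rw [← hG2] at hS
  have hM : M ≤ (N / G) ^ 2 * N := by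
    rw [div_pow, div_mul_eq_mul_div, le_div_iff₀ (by positivity)]
    linarith
  have hNG : (N / G) ^ 2 ≤ 1 := pow_le_one₀ (by positivity) ((div_le_one hG).2 hle)
  have hMN : M ≤ N := hM.trans (mul_le_of_le_one_left hN hNG)
  refine ⟨?_, by linarith, hM⟩
  nlinarith [mul_le_mul_of_nonneg_left hMN hG.le]
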